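/- arXiv:2409.06658 — 2 statements merged into one kernel-verified Lean document; each statement's English description precedes it below -/
import Mathlib

section
/- Let u, λ, x₁, x₂, x₃ ∈ ℂ with Re(λ + u − x₁ − x₂ − x₃) > 0. For each integer k ≥ 0 let η_k^+, η_k^− ∈ ℂ be any numbers satisfying η_k^+ + η_k^− = x₁ + x₂ + x₃ + k and (−k − λ)(η_k^+ − λ)(η_k^− − λ) = (x₁−λ)(x₂−λ)(x₃−λ). Assume x₁, x₂, x₃ and λ are not nonpositive integers, u − x₁, u − x₂, u − x₃ are not nonpositive integers, and η_k^+, η_k^− are not nonpositive integers for all k ≥ 0. Then the series ∑_{k=0}^{∞} [ (−1)^k / k! ] · [ Γ(η_k^+) Γ(η_k^−) / ( Γ(u+k) Γ(u−η_k^+) Γ(u−η_k^−) ) ] · ( 1/(x₁+k) + 1/(x₂+k) + 1/(x₃+k) − 1/(λ+k) ) converges and its sum equals Γ(x₁)Γ(x₂)Γ(x₃) / ( Γ(u−x₁)Γ(u−x₂)Γ(u−x₃) ). -/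
open Finset Filter Topology Complex

lemma cse_partial_fraction (s : Finset ℕ) (P Q a b : ℕ → ℂ) (ha : ∀ j ∈ s, a j ≠ 0)
    (hP : ∀ j ∈ s, P j ≠ 0) (hinj : ∀ j ∈ s, ∀ k ∈ s, j ≠ k → P j - P k / a k * a j ≠ 0) :
    ∏ j ∈ s, (Q j / P j) = ∏ j ∈ s, (b j / a j) + ∑ k ∈ s,
      (∏ j ∈ s, (Q j - P k / a k * b j)) / (P k * ∏ j ∈ s.erase k, (P j - P k / a k * a j)) := by
  classical
  set v : ℕ → ℂ := fun j => - (P j / a j) with hv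
  set c : ℂ := ∏ j ∈ s, (b j / a j) with hc
  set N : Polynomial ℂ := ∏ j ∈ s, (Polynomial.C (b j) * Polynomial.X + Polynomial.C (Q j))
    - Polynomial.C c * ∏ j ∈ s, (Polynomial.C (a j) * Polynomial.X + Polynomial.C (P j)) with hN
  have hvs : Set.InjOn v s := by
    intro j hj k hk h
    by_contra hne
    apply hinj j hj k hk hne
    have h' : P j / a j = P k / a k := by simpa [hv] using h
    rw [← h', div_mul_cancel₀ _ (ha j hj), sub_self]
  have hdegle : ∀ f g : ℕ → ℂ, ∀ j, (Polynomial.C (f j) * Polynomial.X + Polynomial.C (g j)).natDegree ≤ 1 := by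
    intro f g j
    exact Polynomial.natDegree_linear_le
  have hpd : ∀ f g : ℕ → ℂ, (∏ j ∈ s, (Polynomial.C (f j) * Polynomial.X + Polynomial.C (g j))).natDegree ≤ #s := by
    intro f g
    refine (Polynomial.natDegree_prod_le _ _).trans ?_
    refine (Finset.sum_le_card_nsmul _ _ 1 (fun j _ => hdegle f g j)).trans ?_
    simp
  have hco : ∀ f g : ℕ → ℂ, (∏ j ∈ s, (Polynomial.C (f j) * Polynomial.X + Polynomial.C (g j))).coeff #s
      = ∏ j ∈ s, f j := by
    intro f g
    have := Polynomial.coeff_prod_of_natDegree_le (s := s)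
      (fun j => (Polynomial.C (f j) * Polynomial.X + Polynomial.C (g j))) 1 (fun j _ => hdegle f g j)
    rw [mul_one] at this
    rw [this]
    exact Finset.prod_congr rfl (fun j _ => by simp [Polynomial.coeff_C])
  have hNdeg : N.degree < #s := by
    rw [Polynomial.degree_lt_iff_coeff_zero]
    intro m hm
    rcases eq_or_lt_of_le hm with h | h
    · rw [← h, hN, Polynomial.coeff_sub, Polynomial.coeff_C_mul, hco, hco, hc, ← Finset.prod_mul_distrib]
      rw [sub_eq_zero]
      refine Finset.prod_congr rfl (fun j hj => ?_)
      rw [div_mul_cancel₀ _ (ha j hj)]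
    · rw [hN, Polynomial.coeff_sub, Polynomial.coeff_C_mul,
        Polynomial.coeff_eq_zero_of_natDegree_lt ((hpd b Q).trans_lt h),
        Polynomial.coeff_eq_zero_of_natDegree_lt ((hpd a P).trans_lt h)]
      simp
  have hint := Lagrange.eq_interpolate hvs hNdeg
  have h0 := congrArg (Polynomial.eval 0) hint
  rw [Lagrange.interpolate_apply, Polynomial.eval_finsetSum] at h0
  have hN0 : N.eval 0 = ∏ j ∈ s, Q j - c * ∏ j ∈ s, P j := by
    simp [hN, Polynomial.eval_prod]
  have hPP : ∏ j ∈ s, P j ≠ 0 := Finset.prod_ne_zero_iff.mpr hP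
  rw [Finset.prod_div_distrib, div_eq_iff hPP, add_mul, ← sub_eq_iff_eq_add', ← hN0, h0, Finset.sum_mul]
  refine Finset.sum_congr rfl (fun k hk => ?_)
  have hNk : N.eval (v k) = ∏ j ∈ s, (Q j - P k / a k * b j) := by
    rw [hN, Polynomial.eval_sub, Polynomial.eval_mul, Polynomial.eval_prod, Polynomial.eval_prod]
    have : ∏ j ∈ s, Polynomial.eval (v k) (Polynomial.C (a j) * Polynomial.X + Polynomial.C (P j)) = 0 := by
      apply Finset.prod_eq_zero hk
      simp only [hv, Polynomial.eval_add, Polynomial.eval_mul, Polynomial.eval_C, Polynomial.eval_X]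
      field_simp [ha k hk]
      ring
    rw [this, mul_zero, sub_zero]
    refine Finset.prod_congr rfl (fun j _ => ?_)
    simp only [hv, Polynomial.eval_add, Polynomial.eval_mul, Polynomial.eval_C, Polynomial.eval_X]
    ring
  rw [Polynomial.eval_mul, Polynomial.eval_C, hNk, ← Finset.mul_prod_erase s P hk, div_mul_eq_mul_div,
    mul_div_assoc, mul_div_mul_left _ _ (hP k hk), ← Finset.prod_div_distrib]
  congr 1
  rw [Lagrange.basis, Polynomial.eval_prod]
  refine Finset.prod_congr rfl (fun j hj => ?_)
  have hjs := Finset.mem_of_mem_erase hj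
  have hne := hinj j hjs k hk (Finset.ne_of_mem_erase hj)
  have hak := ha k hk
  have haj := ha j hjs
  rw [Lagrange.basisDivisor]
  simp only [hv, Polynomial.eval_sub, Polynomial.eval_mul, Polynomial.eval_C, Polynomial.eval_X]
  have e : -(P k / a k) - -(P j / a j) = (P j - P k / a k * a j) / a j := by
    field_simp
    ring
  rw [e, inv_div]
  field_simp
  ring

lemma cse_root {x₁ x₂ x₃ lam a b k : ℂ} (h1 : a + b = x₁ + x₂ + x₃ + k)
    (h2 : (-k - lam) * (a - lam) * (b - lam) = (x₁ - lam) * (x₂ - lam) * (x₃ - lam))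
    (hk : k + lam ≠ 0) (x : ℂ) :
    (x - x₁) * (x - x₂) * (x - x₃) - (x₁ + k) * (x₂ + k) * (x₃ + k) / (k + lam) * (x - lam)
      = (x + k) * (x - a) * (x - b) := by
  obtain rfl : b = x₁ + x₂ + x₃ + k - a := by linear_combination h1
  field_simp
  linear_combination (x + k) * h2

lemma cse_factor {x₁ x₂ x₃ lam a b k : ℂ} (h1 : a + b = x₁ + x₂ + x₃ + k)
    (h2 : (-k - lam) * (a - lam) * (b - lam) = (x₁ - lam) * (x₂ - lam) * (x₃ - lam))
    (hk : lam + k ≠ 0) (hx₁ : x₁ + k ≠ 0) (hx₂ : x₂ + k ≠ 0) (hx₃ : x₃ + k ≠ 0) :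
    1 / (x₁ + k) + 1 / (x₂ + k) + 1 / (x₃ + k) - 1 / (lam + k) =
     (k + a) * (k + b) / ((x₁ + k) * (x₂ + k) * (x₃ + k)) := by
  obtain rfl : b = x₁ + x₂ + x₃ + k - a := by linear_combination h1
  field_simp
  linear_combination h2

lemma cse_prod_sub (n k : ℕ) (hk : k ≤ n) :
    ∏ j ∈ (range (n + 1)).erase k, ((j : ℂ) - k) = (-1) ^ k * (k.factorial : ℂ) * ((n - k).factorial : ℂ) := by
  obtain ⟨m, rfl⟩ := Nat.exists_eq_add_of_le hk
  have h : (range (k + m + 1)).erase k = range k ∪ (range m).map (addRightEmbedding (k + 1)) := by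
    ext j
    simp only [mem_erase, mem_range, mem_union, Finset.mem_map, addRightEmbedding_apply]
    constructor
    · rintro ⟨h1, h2⟩
      rcases lt_or_gt_of_ne h1 with h | h
      · exact Or.inl h
      · exact Or.inr ⟨j - (k + 1), by omega, by omega⟩
    · rintro (h | ⟨i, hi, rfl⟩) <;> omega
  rw [h, prod_union, prod_map]
  · rw [Nat.add_sub_cancel_left]
    congr 1
    · rw [← Finset.prod_range_reflect, ← Finset.prod_range_add_one_eq_factorial, Nat.cast_prod,
        ← Finset.card_range k, ← Finset.prod_const, Finset.card_range, ← Finset.prod_mul_distrib]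
      refine Finset.prod_congr rfl (fun j hj => ?_)
      rw [mem_range] at hj
      have : k - 1 - j + (j + 1) = k := by omega
      have h2 : ((k - 1 - j : ℕ) : ℂ) + (j + 1) = k := by exact_mod_cast this
      push_cast
      linear_combination h2
    · rw [← Finset.prod_range_add_one_eq_factorial, Nat.cast_prod]
      refine Finset.prod_congr rfl (fun j hj => ?_)
      simp only [addRightEmbedding_apply]
      push_cast
      ring
  · rw [Finset.disjoint_left]
    intro j hj
    simp only [mem_range] at hj
    simp only [Finset.mem_map, mem_range, addRightEmbedding_apply, not_exists, not_and]
    intro i _ h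
    omega

lemma cse_finite_term (u S a b W : ℂ) (n k : ℕ) (hn : n ≠ 0) (hk : k ≤ n) (h1 : a + b = S + k)
    (ha : ∏ j ∈ range (n + 1), (a + j) ≠ 0) (hb : ∏ j ∈ range (n + 1), (b + j) ≠ 0) :
    ((-1 : ℂ) ^ k / (k.factorial : ℂ)) * ((n.descFactorial k : ℂ) / (n : ℂ) ^ k)
        * (GammaSeq a n * GammaSeq b n / (GammaSeq (u + k) n * GammaSeq (u - a) n * GammaSeq (u - b) n))
        * W =
    (n : ℂ) ^ (2 * S - 3 * u) * (((-1 : ℂ) ^ k / ((k.factorial : ℂ) * ((n - k).factorial : ℂ)))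
      * ((∏ j ∈ range (n + 1), (u + k + j)) * (∏ j ∈ range (n + 1), (u - a + j))
        * (∏ j ∈ range (n + 1), (u - b + j)) / ((∏ j ∈ range (n + 1), (a + j)) *
          ∏ j ∈ range (n + 1), (b + j)))) * W := by
  have hn' : (n : ℂ) ≠ 0 := Nat.cast_ne_zero.mpr hn
  have hS : 2 * S - 3 * u = (a + a + (b + b)) - (u + (u + u)) - (k + k : ℂ) := by
    linear_combination (-2) * h1
  have hz : ∀ z : ℂ, (n : ℂ) ^ z ≠ 0 := fun z => by
    rw [Ne, cpow_eq_zero_iff]; tauto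
  have hd : (n.factorial : ℂ) = ((n - k).factorial : ℂ) * n.descFactorial k := by
    exact_mod_cast (Nat.factorial_mul_descFactorial hk).symm
  rw [hS]
  simp only [cpow_sub _ _ hn', cpow_add _ _ hn', cpow_natCast, GammaSeq]
  have h1 := hz a
  have h2 := hz b
  have h3 := hz u
  have h5 : (n.factorial : ℂ) ≠ 0 := Nat.cast_ne_zero.mpr n.factorial_ne_zero
  have h4 : ((n - k).factorial : ℂ) ≠ 0 := Nat.cast_ne_zero.mpr (n-k).factorial_ne_zero
  have h6 : (n.descFactorial k : ℂ) = n.factorial / (n - k).factorial := by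
    rw [hd]; field_simp
  rw [h6]
  generalize ∏ j ∈ range (n + 1), (a + (j : ℂ)) = pa at *
  generalize ∏ j ∈ range (n + 1), (b + (j : ℂ)) = pb at *
  generalize ∏ j ∈ range (n + 1), (u + k + (j : ℂ)) = p1 at *
  generalize ∏ j ∈ range (n + 1), (u - a + (j : ℂ)) = p2 at *
  generalize ∏ j ∈ range (n + 1), (u - b + (j : ℂ)) = p3 at *
  generalize (n : ℂ) ^ a = na at *
  generalize (n : ℂ) ^ b = nb at *
  generalize (n : ℂ) ^ u = nu at *
  generalize (n.factorial : ℂ) = nf at *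
  simp only [div_eq_mul_inv, mul_inv, inv_inv]
  field_simp

lemma cse_finite_lhs (u x₁ x₂ x₃ : ℂ) (n : ℕ) (hn : n ≠ 0) :
    GammaSeq x₁ n * GammaSeq x₂ n * GammaSeq x₃ n /
      (GammaSeq (u - x₁) n * GammaSeq (u - x₂) n * GammaSeq (u - x₃) n) =
    (n : ℂ) ^ (2 * (x₁ + x₂ + x₃) - 3 * u) * ∏ j ∈ range (n + 1),
      ((u + j - x₁) * (u + j - x₂) * (u + j - x₃) / ((x₁ + j) * (x₂ + j) * (x₃ + j))) := by
  have hn' : (n : ℂ) ≠ 0 := Nat.cast_ne_zero.mpr hn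
  have hS : 2 * (x₁ + x₂ + x₃) - 3 * u = (x₁ + x₁ + (x₂ + x₂) + (x₃ + x₃)) - (u + (u + u)) := by
    ring
  have hz : ∀ z : ℂ, (n : ℂ) ^ z ≠ 0 := fun z => by
    rw [Ne, cpow_eq_zero_iff]; tauto
  have h1 := hz x₁
  have h2 := hz x₂
  have h3 := hz x₃
  have h4 := hz u
  have h5 : (n.factorial : ℂ) ≠ 0 := Nat.cast_ne_zero.mpr n.factorial_ne_zero
  have he : ∀ x : ℂ, ∏ j ∈ range (n + 1), (u - x + (j : ℂ)) = ∏ j ∈ range (n + 1), (u + j - x) :=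
    fun x => Finset.prod_congr rfl (fun j _ => by ring)
  rw [hS]
  simp only [cpow_sub _ _ hn', cpow_add _ _ hn', GammaSeq, Finset.prod_div_distrib,
    Finset.prod_mul_distrib, he]
  simp only [div_eq_mul_inv, mul_inv, inv_inv]
  field_simp

lemma cse_finite (u lam x₁ x₂ x₃ : ℂ) (ηp ηm : ℕ → ℂ)
    (hη : ∀ k : ℕ, ηp k + ηm k = x₁ + x₂ + x₃ + k
      ∧ (-(k : ℂ) - lam) * (ηp k - lam) * (ηm k - lam)
          = (x₁ - lam) * (x₂ - lam) * (x₃ - lam))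
    (hx₁ : ∀ m : ℕ, x₁ + m ≠ 0) (hx₂ : ∀ m : ℕ, x₂ + m ≠ 0) (hx₃ : ∀ m : ℕ, x₃ + m ≠ 0)
    (hlam : ∀ m : ℕ, lam + m ≠ 0)
    (hηp : ∀ k : ℕ, ∀ m : ℕ, ηp k + m ≠ 0) (hηm : ∀ k : ℕ, ∀ m : ℕ, ηm k + m ≠ 0)
    (n : ℕ) (hn : n ≠ 0) :
    GammaSeq x₁ n * GammaSeq x₂ n * GammaSeq x₃ n /
      (GammaSeq (u - x₁) n * GammaSeq (u - x₂) n * GammaSeq (u - x₃) n) =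
    (n : ℂ) ^ (2 * (x₁ + x₂ + x₃) - 3 * u) * ∏ j ∈ range (n + 1), ((u + j - lam) / (j + lam))
    + ∑ k ∈ range (n + 1),
      ((-1 : ℂ) ^ k / (k.factorial : ℂ)) * ((n.descFactorial k : ℂ) / (n : ℂ) ^ k)
        * (GammaSeq (ηp k) n * GammaSeq (ηm k) n
          / (GammaSeq (u + k) n * GammaSeq (u - ηp k) n * GammaSeq (u - ηm k) n))
        * (1 / (x₁ + k) + 1 / (x₂ + k) + 1 / (x₃ + k) - 1 / (lam + k)) := by
  have hP : ∀ j k : ℕ, (x₁ + j) * (x₂ + j) * (x₃ + j) -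
      (x₁ + k) * (x₂ + k) * (x₃ + k) / (k + lam) * (j + lam) =
      (j - k : ℂ) * ((ηp k + j) * (ηm k + j)) := by
    intro j k
    have := cse_root (hη k).1 (hη k).2 (by rw [add_comm]; exact hlam k) (-(j : ℂ))
    linear_combination -this
  rw [cse_finite_lhs _ _ _ _ _ hn]
  rw [cse_partial_fraction (range (n + 1)) (fun j => (x₁ + j) * (x₂ + j) * (x₃ + j))
    (fun j => (u + j - x₁) * (u + j - x₂) * (u + j - x₃)) (fun j => j + lam) (fun j => u + j - lam)
    (fun j _ => by rw [add_comm]; exact hlam j)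
    (fun j _ => mul_ne_zero (mul_ne_zero (hx₁ j) (hx₂ j)) (hx₃ j))
    (fun j _ k _ hjk => by
      rw [hP]
      refine mul_ne_zero ?_ (mul_ne_zero (hηp k j) (hηm k j))
      rw [sub_ne_zero]
      exact_mod_cast hjk), mul_add, Finset.mul_sum]
  congr 1
  refine Finset.sum_congr rfl (fun k hk => ?_)
  have hkn : k ≤ n := by rw [mem_range] at hk; omega
  have hpa : ∏ j ∈ range (n + 1), (ηp k + j) ≠ 0 := Finset.prod_ne_zero_iff.mpr fun j _ => hηp k j
  have hpb : ∏ j ∈ range (n + 1), (ηm k + j) ≠ 0 := Finset.prod_ne_zero_iff.mpr fun j _ => hηm k j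
  rw [cse_finite_term u (x₁ + x₂ + x₃) (ηp k) (ηm k) _ n k hn hkn (hη k).1 hpa hpb,
    cse_factor (hη k).1 (hη k).2 (hlam k) (hx₁ k) (hx₂ k) (hx₃ k),
    mul_assoc ((n : ℂ) ^ (2 * (x₁ + x₂ + x₃) - 3 * u))]
  congr 1
  have hnum : ∏ j ∈ range (n + 1), ((u + j - x₁) * (u + j - x₂) * (u + j - x₃) -
      (x₁ + k) * (x₂ + k) * (x₃ + k) / (k + lam) * (u + j - lam)) =
      (∏ j ∈ range (n + 1), (u + k + j)) * (∏ j ∈ range (n + 1), (u - ηp k + j))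
        * (∏ j ∈ range (n + 1), (u - ηm k + j)) := by
    rw [← Finset.prod_mul_distrib, ← Finset.prod_mul_distrib]
    refine Finset.prod_congr rfl (fun j _ => ?_)
    rw [cse_root (hη k).1 (hη k).2 (by rw [add_comm]; exact hlam k) (u + j : ℂ)]
    ring
  rw [hnum]
  simp only [hP]
  rw [Finset.prod_mul_distrib, cse_prod_sub n k hkn, Finset.prod_mul_distrib]
  rw [← Finset.mul_prod_erase _ _ hk] at hpa hpb
  rw [← Finset.mul_prod_erase (range (n+1)) (fun j : ℕ => ηp k + (j : ℂ)) hk,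
    ← Finset.mul_prod_erase (range (n+1)) (fun j : ℕ => ηm k + (j : ℂ)) hk]
  obtain ⟨e1, e2⟩ := mul_ne_zero_iff.mp hpa
  obtain ⟨e3, e4⟩ := mul_ne_zero_iff.mp hpb
  have g1 := hx₁ k
  have g2 := hx₂ k
  have g3 := hx₃ k
  have h5 : (k.factorial : ℂ) ≠ 0 := Nat.cast_ne_zero.mpr k.factorial_ne_zero
  have h4 : ((n - k).factorial : ℂ) ≠ 0 := Nat.cast_ne_zero.mpr (n-k).factorial_ne_zero
  have hs : ((-1 : ℂ) ^ k) * (-1) ^ k = 1 := by rw [← mul_pow]; simp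
  have hs' : ((-1 : ℂ) ^ k) = ((-1) ^ k)⁻¹ := eq_inv_of_mul_eq_one_left hs
  have hs0 : ((-1 : ℂ) ^ k) ≠ 0 := left_ne_zero_of_mul_eq_one hs
  rw [add_comm (k : ℂ) (ηp k), add_comm (k : ℂ) (ηm k)]
  generalize ∏ j ∈ (range (n + 1)).erase k, (ηp k + (j : ℂ)) = p1 at *
  generalize ∏ j ∈ (range (n + 1)).erase k, (ηm k + (j : ℂ)) = p2 at *
  generalize ((-1 : ℂ) ^ k) = sg at *
  rcases mul_self_eq_one_iff.mp hs with rfl | rfl <;> field_simp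

lemma cse_norm_one_add (w : ℂ) : ‖1 + w‖ ≤ Real.exp (w.re + ‖w‖ ^ 2 / 2) := by
  have h1 : ‖1 + w‖ ^ 2 = 2 * (w.re + ‖w‖ ^ 2 / 2) + 1 := by
    rw [Complex.sq_norm, Complex.sq_norm, Complex.normSq_apply, Complex.normSq_apply]
    simp
    ring
  have h2 : ‖1 + w‖ ^ 2 ≤ Real.exp (w.re + ‖w‖ ^ 2 / 2) ^ 2 := by
    rw [h1, ← Real.exp_nat_mul]
    exact_mod_cast Real.add_one_le_exp _
  exact (abs_le_of_sq_le_sq' h2 (Real.exp_pos _).le).2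

lemma cse_ratio {M c : ℝ} (hc : 0 < c) {z z' : ℂ} (hz : ‖z‖ ≤ M) (hz' : ‖z'‖ ≤ M) (j : ℕ)
    (hj : c * (j + 1) ≤ ‖z' + j‖) :
    ‖(z + j) / (z' + j)‖ ≤ Real.exp ((z - z').re * (1 / ((j : ℝ) + 1)) +
      (2 * M * (1 + M) / c + (2 * M / c) ^ 2 / 2) * (1 / ((j : ℝ) + 1) ^ 2)) := by
  have hM : 0 ≤ M := (norm_nonneg _).trans hz
  have hj1 : (0 : ℝ) < (j : ℝ) + 1 := by positivity
  have hpos : 0 < ‖z' + j‖ := lt_of_lt_of_le (by positivity) hj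
  have hne : z' + j ≠ 0 := norm_pos_iff.mp hpos
  have hjc : ((j : ℂ) + 1) ≠ 0 := by exact_mod_cast hj1.ne'
  set w := (z - z') / (z' + j) with hw
  have e1 : (z + j) / (z' + j) = 1 + w := by rw [hw]; field_simp; ring
  rw [e1]
  refine (cse_norm_one_add w).trans (Real.exp_le_exp.mpr ?_)
  have hzz : ‖z - z'‖ ≤ 2 * M := (norm_sub_le _ _).trans (by linarith)
  have hw1 : ‖w‖ ≤ 2 * M / c * (1 / ((j : ℝ) + 1)) := by
    rw [hw, norm_div, div_mul_div_comm, mul_one]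
    gcongr
  have hw2 : ‖w‖ ^ 2 / 2 ≤ (2 * M / c) ^ 2 / 2 * (1 / ((j : ℝ) + 1) ^ 2) := by
    have : ‖w‖ ^ 2 ≤ (2 * M / c * (1 / ((j : ℝ) + 1))) ^ 2 := by gcongr
    calc ‖w‖ ^ 2 / 2 ≤ (2 * M / c * (1 / ((j : ℝ) + 1))) ^ 2 / 2 := by gcongr
      _ = _ := by field_simp
  have e2 : w - (z - z') * ((1 / ((j : ℝ) + 1) : ℝ) : ℂ) = (z - z') * (1 - z') / ((z' + j) * (j + 1)) := by
    rw [hw]; push_cast; field_simp; ring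
  have hw3 : (w - (z - z') * ((1 / ((j : ℝ) + 1) : ℝ) : ℂ)).re ≤ 2 * M * (1 + M) / c * (1 / ((j : ℝ) + 1) ^ 2) := by
    refine (Complex.re_le_norm _).trans ?_
    rw [e2, norm_div, norm_mul, norm_mul, div_mul_div_comm, mul_one]
    have h1 : ‖1 - z'‖ ≤ 1 + M := (norm_sub_le _ _).trans (by simpa using hz')
    have h2 : ‖(j : ℂ) + 1‖ = j + 1 := by
      rw [← Nat.cast_add_one, Complex.norm_natCast]; push_cast; rfl
    rw [h2]
    have h3 : c * ((j : ℝ) + 1) ^ 2 ≤ ‖z' + j‖ * (j + 1) := by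
      rw [sq, ← mul_assoc]; gcongr
    gcongr
  rw [Complex.sub_re, Complex.re_mul_ofReal] at hw3
  linarith

lemma cse_ratio_prod {M c : ℝ} (hc : 0 < c) {z z' : ℂ} (hz : ‖z‖ ≤ M) (hz' : ‖z'‖ ≤ M) (s : Finset ℕ)
    (hj : ∀ j ∈ s, c * (j + 1) ≤ ‖z' + j‖) :
    ∏ j ∈ s, ‖(z + j) / (z' + j)‖ ≤ Real.exp ((z - z').re * (∑ j ∈ s, 1 / ((j : ℝ) + 1)) +
      (2 * M * (1 + M) / c + (2 * M / c) ^ 2 / 2) * ∑' j : ℕ, (1 / ((j : ℝ) + 1) ^ 2)) := by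
  have hM : 0 ≤ M := (norm_nonneg _).trans hz
  calc _ ≤ ∏ j ∈ s, Real.exp ((z - z').re * (1 / ((j : ℝ) + 1)) +
      (2 * M * (1 + M) / c + (2 * M / c) ^ 2 / 2) * (1 / ((j : ℝ) + 1) ^ 2)) :=
        Finset.prod_le_prod (fun _ _ => norm_nonneg _) (fun j h => cse_ratio hc hz hz' j (hj j h))
    _ ≤ _ := by
      rw [← Real.exp_sum, Finset.sum_add_distrib, ← Finset.mul_sum, ← Finset.mul_sum]
      gcongr
      refine Summable.sum_le_tsum _ (fun j _ => by positivity) ?_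
      have := (summable_nat_add_iff 1).mpr (Real.summable_one_div_nat_pow.mpr (one_lt_two))
      simpa using this

noncomputable def cseH (n : ℕ) : ℝ := ∑ j ∈ range n, 1 / ((j : ℝ) + 1)

lemma cseH_eq (n : ℕ) : cseH n = (harmonic n : ℝ) := by
  simp [cseH, harmonic]

lemma cseH_lower (n : ℕ) : Real.log (n + 1) ≤ cseH n := by
  rw [cseH_eq]; exact_mod_cast log_add_one_le_harmonic n

lemma cseH_upper (n : ℕ) : cseH n ≤ 1 + Real.log n := by
  rw [cseH_eq]; exact harmonic_le_one_add_log n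

lemma cseH_succ (n : ℕ) : cseH (n + 1) = cseH n + 1 / ((n : ℝ) + 1) := by
  rw [cseH, Finset.sum_range_succ]; rfl

lemma cseH_mono : Monotone cseH := by
  refine monotone_nat_of_le_succ (fun n => ?_)
  rw [cseH_succ]
  have : (0 : ℝ) ≤ 1 / ((n : ℝ) + 1) := by positivity
  linarith

lemma cseH_add (n k : ℕ) : cseH (n + k) ≤ cseH n + k / ((n : ℝ) + 1) := by
  induction k with
  | zero => simp
  | succ k ih =>
    rw [← add_assoc, cseH_succ]
    have : 1 / (((n + k : ℕ) : ℝ) + 1) ≤ 1 / ((n : ℝ) + 1) := by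
      push_cast
      gcongr
      linarith [(Nat.cast_nonneg k : (0 : ℝ) ≤ k)]
    push_cast at *
    rw [add_div]
    linarith

lemma cse_lower (z : ℂ) (hz : ∀ m : ℕ, z + m ≠ 0) :
    ∃ c : ℝ, 0 < c ∧ ∀ j : ℕ, c * (j + 1) ≤ ‖z + j‖ := by
  have h : ∀ J : ℕ, ∃ c : ℝ, 0 < c ∧ ∀ j : ℕ, j < J → c * (j + 1) ≤ ‖z + j‖ := by
    intro J
    induction J with
    | zero => exact ⟨1, one_pos, fun j hj => absurd hj (Nat.not_lt_zero _)⟩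
    | succ J ih =>
      obtain ⟨c, hc, h⟩ := ih
      have hp : 0 < ‖z + J‖ := norm_pos_iff.mpr (hz J)
      refine ⟨min c (‖z + J‖ / (J + 1)), lt_min hc (by positivity), fun j hj => ?_⟩
      rcases Nat.lt_succ_iff_lt_or_eq.mp hj with h1 | rfl
      · exact (mul_le_mul_of_nonneg_right (min_le_left _ _) (by positivity)).trans (h j h1)
      · refine (mul_le_mul_of_nonneg_right (min_le_right _ _) (by positivity)).trans ?_
        rw [div_mul_cancel₀ _ (by positivity)]
  obtain ⟨J, hJ⟩ := exists_nat_ge (2 * ‖z‖ + 1)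
  obtain ⟨c, hc, h⟩ := h J
  refine ⟨min c (1 / 2), lt_min hc (by norm_num), fun j => ?_⟩
  rcases lt_or_ge j J with h1 | h1
  · exact (mul_le_mul_of_nonneg_right (min_le_left _ _) (by positivity)).trans (h j h1)
  · refine (mul_le_mul_of_nonneg_right (min_le_right _ _) (by positivity)).trans ?_
    have h2 : (J : ℝ) ≤ j := by exact_mod_cast h1
    have h3 : ‖(j : ℂ)‖ ≤ ‖z + j‖ + ‖z‖ := by
      have := norm_sub_le (z + j) z
      simpa using this
    rw [Complex.norm_natCast] at h3
    linarith

set_option maxHeartbeats 2000000 in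
lemma cse_core (u lam S : ℂ) (hδ : 0 < (lam + u - S).re) (hlam : ∀ m : ℕ, lam + m ≠ 0) :
    ∃ C ε₀ : ℝ, ∃ k₀ : ℕ, 0 < C ∧ 0 < ε₀ ∧ ∀ k ≥ k₀, ∀ n : ℕ, n ≠ 0 → k ≤ n → ∀ a b : ℂ, ‖b - lam‖ ≤ ε₀ →
      a + b = S + k →
      ‖(n : ℂ) ^ (2 * S - 3 * u) * (((-1 : ℂ) ^ k / ((k.factorial : ℂ) * ((n - k).factorial : ℂ)))
      * ((∏ j ∈ range (n + 1), (u + k + j)) * (∏ j ∈ range (n + 1), (u - a + j))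
        * (∏ j ∈ range (n + 1), (u - b + j)) / ((∏ j ∈ range (n + 1), (a + j)) *
          ∏ j ∈ range (n + 1), (b + j))))‖ ≤ C * Real.exp (-(lam + u - S).re * cseH k) := by
  set δ := (lam + u - S).re with hδdef
  obtain ⟨cl, hcl, hcl'⟩ := cse_lower lam hlam
  set M : ℝ := ‖u‖ + ‖lam‖ + ‖S‖ + 3 with hM
  set ε₀ : ℝ := min (min 1 (δ / 2)) (cl / 2) with hε₀
  have hε1 : ε₀ ≤ 1 := (min_le_left _ _).trans (min_le_left _ _)
  have hε2 : ε₀ ≤ δ / 2 := (min_le_left _ _).trans (min_le_right _ _)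
  have hε3 : ε₀ ≤ cl / 2 := min_le_right _ _
  have hε0 : 0 < ε₀ := lt_min (lt_min one_pos (by linarith)) (by linarith)
  set c : ℝ := min (1 / 2) (cl / 2) with hcdef
  have hc : 0 < c := lt_min (by norm_num) (by linarith)
  have hc1 : c ≤ 1 / 2 := min_le_left _ _
  have hc2 : c ≤ cl / 2 := min_le_right _ _
  set E : ℝ := (2 * M * (1 + M) / c + (2 * M / c) ^ 2 / 2) * ∑' j : ℕ, (1 / ((j : ℝ) + 1) ^ 2) with hE
  obtain ⟨k₀, hk₀⟩ := exists_nat_ge (2 * M + 1)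
  set r : ℝ := (2 * S - 3 * u).re with hr
  refine ⟨Real.exp (4 * E + 2 * |r| + M), ε₀, k₀, Real.exp_pos _, hε0, ?_⟩
  intro k hk n hn hkn a b hb hab
  obtain ⟨ε, rfl⟩ : ∃ ε, b = lam + ε := ⟨b - lam, by ring⟩
  rw [add_sub_cancel_left] at hb
  set v := S - lam - ε with hv
  obtain rfl : a = k + v := by rw [hv]; linear_combination hab
  set γ := lam + u - S + ε with hγ
  have n1 := norm_nonneg u
  have n2 := norm_nonneg lam
  have n3 := norm_nonneg S
  have bε : ‖ε‖ ≤ 1 := hb.trans hε1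
  have bu : ‖u‖ ≤ M := by linarith
  have bl : ‖lam + ε‖ ≤ M := (norm_add_le _ _).trans (by linarith)
  have bul : ‖u - (lam + ε)‖ ≤ M := (norm_sub_le _ _).trans (by linarith [norm_add_le lam ε])
  have bv : ‖v‖ ≤ M := (norm_sub_le _ _).trans (by linarith [norm_sub_le S lam])
  have bγ' : ‖γ‖ ≤ M - 1 := by
    refine (norm_add_le _ _).trans ?_
    linarith [norm_sub_le (lam + u) S, norm_add_le lam u]
  have bγ : ‖γ‖ ≤ M := by linarith
  have b1γ : ‖1 - γ‖ ≤ M := (norm_sub_le _ _).trans (by rw [norm_one]; linarith)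
  have b1 : ‖(1 : ℂ)‖ ≤ M := by rw [norm_one]; linarith
  have hg1 : δ / 2 ≤ γ.re := by
    have : |ε.re| ≤ ‖ε‖ := Complex.abs_re_le_norm ε
    have h2 := neg_abs_le ε.re
    rw [hγ, Complex.add_re, ← hδdef]
    linarith
  have hg2 : γ.re ≤ M := (Complex.re_le_norm _).trans bγ
  have low1 : ∀ j : ℕ, c * (j + 1) ≤ ‖(1 : ℂ) + j‖ := by
    intro j
    have h2 : ‖(1 : ℂ) + j‖ = j + 1 := by
      rw [add_comm, ← Nat.cast_add_one, Complex.norm_natCast]; push_cast; rfl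
    rw [h2]
    have : (0 : ℝ) ≤ j := Nat.cast_nonneg j
    nlinarith
  have lowl : ∀ j : ℕ, c * (j + 1) ≤ ‖(lam + ε) + j‖ := by
    intro j
    have h1 := hcl' j
    have h2 : ‖lam + j‖ ≤ ‖(lam + ε) + j‖ + ‖ε‖ := by
      have := norm_sub_le ((lam + ε) + j) ε
      rwa [show lam + ε + j - ε = lam + j by ring] at this
    have : (0 : ℝ) ≤ j := Nat.cast_nonneg j
    nlinarith
  have lowv : ∀ j ∈ Finset.Ico k (n + k + 1), c * (j + 1) ≤ ‖v + j‖ := by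
    intro j hj
    have hj1 : k₀ ≤ j := hk.trans (Finset.mem_Ico.mp hj).1
    have hj2 : (k₀ : ℝ) ≤ j := by exact_mod_cast hj1
    have h3 : ‖(j : ℂ)‖ ≤ ‖v + j‖ + ‖v‖ := by
      have := norm_sub_le (v + j) v
      simpa using this
    rw [Complex.norm_natCast] at h3
    have : (0 : ℝ) ≤ j := Nat.cast_nonneg j
    nlinarith
  have p1 := cse_ratio_prod hc b1γ b1 (range k) (fun j _ => low1 j)
  have p2 := cse_ratio_prod hc bγ b1 (range (n - k + 1)) (fun j _ => low1 j)
  have p3 := cse_ratio_prod hc bu bv (Finset.Ico k (n + k + 1)) lowv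
  have p4 := cse_ratio_prod hc bul bl (range (n + 1)) (fun j _ => lowl j)
  have hico : ∑ j ∈ Finset.Ico k (n + k + 1), 1 / ((j : ℝ) + 1) = cseH (n + k + 1) - cseH k :=
    Finset.sum_Ico_eq_sub _ (by omega)
  rw [hico, ← hE] at p3
  rw [← hE] at p1 p2 p4
  change _ ≤ Real.exp (_ * cseH k + E) at p1
  change _ ≤ Real.exp (_ * cseH (n - k + 1) + E) at p2
  change _ ≤ Real.exp (_ * cseH (n + 1) + E) at p4
  have r1 : (1 - γ - 1).re = -γ.re := by simp
  have r2 : (γ - 1).re = γ.re - 1 := by simp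
  have r3 : (u - v).re = γ.re := by rw [hv, hγ]; congr 1; ring
  have r4 : (u - (lam + ε) - (lam + ε)).re = -2 * γ.re - r := by
    rw [hr, hγ]; simp; ring
  rw [r1] at p1
  rw [r2] at p2
  rw [r3] at p3
  rw [r4] at p4
  have p2' : ((n - k + 1 : ℕ) : ℝ) * ∏ j ∈ range (n - k + 1), ‖(γ + j) / (1 + j)‖
      ≤ Real.exp (γ.re * cseH (n - k + 1) + E) := by
    have : ((n - k + 1 : ℕ) : ℝ) ≤ Real.exp (cseH (n - k + 1)) := by
      have h := cseH_lower (n - k + 1)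
      have hp : (0 : ℝ) < ((n - k + 1 : ℕ) : ℝ) := by positivity
      rw [← Real.log_le_iff_le_exp hp]
      refine le_trans (Real.log_le_log hp (by linarith)) h
    calc _ ≤ Real.exp (cseH (n - k + 1)) * Real.exp ((γ.re - 1) * cseH (n - k + 1) + E) := by
            gcongr
      _ = _ := by rw [← Real.exp_add]; congr 1; ring
  have hn0 : (0 : ℝ) < n := by exact_mod_cast Nat.pos_of_ne_zero hn
  have p5 : ‖(n : ℂ) ^ (2 * S - 3 * u)‖ ≤ Real.exp (r * cseH (n + 1) + 2 * |r|) := by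
    rw [← Complex.ofReal_natCast, Complex.norm_cpow_eq_rpow_re_of_pos hn0, Real.rpow_def_of_pos hn0,
      Real.exp_le_exp, ← hr]
    have h1 : Real.log n ≤ cseH (n + 1) := by
      refine le_trans (Real.log_le_log hn0 ?_) (cseH_lower (n + 1))
      push_cast; linarith
    have h2 : cseH (n + 1) ≤ 2 + Real.log n := by
      rw [cseH_succ]
      have h3 := cseH_upper n
      have h4 : 1 / ((n : ℝ) + 1) ≤ 1 := by
        rw [div_le_one (by positivity)]; linarith
      linarith
    have h3 : r * (Real.log n - cseH (n + 1)) ≤ |r| * 2 := by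
      refine (le_abs_self _).trans ?_
      rw [abs_mul]
      gcongr
      rw [abs_le]; constructor <;> linarith
    linarith
  have key : ‖(n : ℂ) ^ (2 * S - 3 * u) * (((-1 : ℂ) ^ k / ((k.factorial : ℂ) * ((n - k).factorial : ℂ)))
      * ((∏ j ∈ range (n + 1), (u + k + j)) * (∏ j ∈ range (n + 1), (u - (k + v) + j))
        * (∏ j ∈ range (n + 1), (u - (lam + ε) + j)) / ((∏ j ∈ range (n + 1), (k + v + j)) *
          ∏ j ∈ range (n + 1), (lam + ε + j))))‖ =
      ‖(n : ℂ) ^ (2 * S - 3 * u)‖ * ((∏ j ∈ range k, ‖(1 - γ + j) / (1 + j)‖) *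
       (((n - k + 1 : ℕ) : ℝ) * ∏ j ∈ range (n - k + 1), ‖(γ + j) / (1 + j)‖) *
       (∏ j ∈ Finset.Ico k (n + k + 1), ‖(u + j) / (v + j)‖) *
       ∏ j ∈ range (n + 1), ‖(u - (lam + ε) + j) / (lam + ε + j)‖) := by
    have q3 : ∏ j ∈ Finset.Ico k (n + k + 1), ‖(u + j) / (v + j)‖ =
        ‖∏ j ∈ range (n + 1), (u + k + j)‖ / ‖∏ j ∈ range (n + 1), (k + v + (j : ℂ))‖ := by
      rw [Finset.prod_Ico_eq_prod_range, ← norm_div, ← Finset.prod_div_distrib, norm_prod,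
        show n + k + 1 - k = n + 1 by omega]
      refine Finset.prod_congr rfl (fun j _ => ?_)
      push_cast
      congr 2 <;> ring
    have q4 : ∏ j ∈ range (n + 1), ‖(u - (lam + ε) + j) / (lam + ε + j)‖ =
        ‖∏ j ∈ range (n + 1), (u - (lam + ε) + j)‖ / ‖∏ j ∈ range (n + 1), (lam + ε + (j : ℂ))‖ := by
      rw [← norm_div, ← Finset.prod_div_distrib, norm_prod]
    have qf : ∀ m : ℕ, ∏ j ∈ range m, ‖(1 : ℂ) + j‖ = m.factorial := by
      intro m
      rw [← Finset.prod_range_add_one_eq_factorial, Nat.cast_prod]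
      refine Finset.prod_congr rfl (fun j _ => ?_)
      rw [add_comm, ← Nat.cast_add_one, Complex.norm_natCast]
    have q12 : ‖∏ j ∈ range (n + 1), (u - (k + v) + j)‖ =
        (∏ j ∈ range k, ‖1 - γ + j‖) * ∏ j ∈ range (n - k + 1), ‖γ + j‖ := by
      rw [norm_prod, show n + 1 = k + (n - k + 1) by omega, Finset.prod_range_add]
      congr 1
      · rw [← Finset.prod_range_reflect]
        refine Finset.prod_congr rfl (fun j hj => ?_)
        rw [mem_range] at hj
        have h2 : ((k - 1 - j : ℕ) : ℂ) + (j + 1) = k := by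
          have : k - 1 - j + (j + 1) = k := by omega
          exact_mod_cast this
        rw [← norm_neg]
        congr 1
        rw [hγ, hv]
        linear_combination -h2
      · refine Finset.prod_congr rfl (fun j hj => ?_)
        congr 1
        rw [hγ, hv]
        push_cast
        ring
    rw [q3, q4]
    simp only [norm_mul, norm_div, norm_pow, norm_neg, norm_one, one_pow, Finset.prod_div_distrib, qf, q12,
      Complex.norm_natCast]
    rw [Nat.factorial_succ]
    have h5 : (k.factorial : ℝ) ≠ 0 := Nat.cast_ne_zero.mpr k.factorial_ne_zero
    have h4 : ((n - k).factorial : ℝ) ≠ 0 := Nat.cast_ne_zero.mpr (n-k).factorial_ne_zero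
    have h6 : ((n - k + 1 : ℕ) : ℝ) ≠ 0 := Nat.cast_ne_zero.mpr (Nat.succ_ne_zero _)
    push_cast at h6 ⊢
    generalize ((n - k : ℕ) : ℝ) + 1 = t at *
    simp only [div_eq_mul_inv, mul_inv]
    have h7 : t * t⁻¹ = 1 := mul_inv_cancel₀ h6
    linear_combination (-(‖(n : ℂ) ^ (2 * S - 3 * u)‖ * (∏ j ∈ range k, ‖1 - γ + j‖) * ((k.factorial : ℝ))⁻¹ *
      (∏ j ∈ range (n - k + 1), ‖γ + j‖) * (((n - k).factorial : ℝ))⁻¹ *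
      ‖∏ j ∈ range (n + 1), (u + k + j)‖ * ‖∏ j ∈ range (n + 1), (k + v + (j : ℂ))‖⁻¹ *
      ‖∏ j ∈ range (n + 1), (u - (lam + ε) + j)‖ * ‖∏ j ∈ range (n + 1), (lam + ε + (j : ℂ))‖⁻¹)) * h7
  rw [key]
  calc _ ≤ Real.exp (r * cseH (n + 1) + 2 * |r|) * (Real.exp (-γ.re * cseH k + E) *
        Real.exp (γ.re * cseH (n - k + 1) + E) * Real.exp (γ.re * (cseH (n + k + 1) - cseH k) + E) *
        Real.exp ((-2 * γ.re - r) * cseH (n + 1) + E)) := by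
          have nn : ∀ (s : Finset ℕ) (f : ℕ → ℂ), 0 ≤ ∏ j ∈ s, ‖f j‖ :=
            fun s f => Finset.prod_nonneg (fun j _ => norm_nonneg _)
          refine mul_le_mul p5 (mul_le_mul (mul_le_mul (mul_le_mul p1 p2' ?_ ?_) p3 (nn _ _) ?_) p4
            (nn _ _) ?_) ?_ (Real.exp_pos _).le
          · exact mul_nonneg (Nat.cast_nonneg _) (nn _ _)
          · positivity
          · positivity
          · positivity
          · exact mul_nonneg (mul_nonneg (mul_nonneg (nn _ _) (mul_nonneg (Nat.cast_nonneg _) (nn _ _)))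
              (nn _ _)) (nn _ _)
    _ ≤ _ := by
      rw [← Real.exp_add, ← Real.exp_add, ← Real.exp_add, ← Real.exp_add, ← Real.exp_add, Real.exp_le_exp]
      have h1 : cseH (n - k + 1) ≤ cseH (n + 1) := cseH_mono (by omega)
      have h2 : cseH (n + k + 1) ≤ cseH (n + 1) + 1 := by
        have h := cseH_add (n + 1) k
        rw [show n + 1 + k = n + k + 1 by omega] at h
        have h3 : (k : ℝ) / (((n + 1 : ℕ) : ℝ) + 1) ≤ 1 := by
          rw [div_le_one (by positivity)]
          have : (k : ℝ) ≤ n := by exact_mod_cast hkn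
          push_cast; linarith
        linarith
      have h0 : 0 ≤ cseH k := by
        have := cseH_mono (Nat.zero_le k)
        simpa [cseH] using this
      have hg0 : 0 ≤ γ.re := by linarith
      have h3 : γ.re * (cseH (n - k + 1) + cseH (n + k + 1) - 2 * cseH (n + 1)) ≤ γ.re * 1 := by
        gcongr; linarith
      have h4 : δ / 2 * cseH k ≤ γ.re * cseH k := by gcongr
      linarith

lemma cse_inv_tendsto (s : ℂ) : Tendsto (fun n => (GammaSeq s n)⁻¹) atTop (𝓝 (Gamma s)⁻¹) := by
  by_cases h : Gamma s = 0
  · obtain ⟨m, rfl⟩ := (Complex.Gamma_eq_zero_iff s).mp h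
    rw [h]
    refine tendsto_const_nhds.congr' ?_
    filter_upwards [eventually_ge_atTop m] with n hn
    have : ∏ j ∈ Finset.range (n + 1), (-(m : ℂ) + j) = 0 :=
      Finset.prod_eq_zero (Finset.mem_range.mpr (Nat.lt_succ_of_le hn)) (by simp)
    rw [GammaSeq, this]
    simp
  · exact (GammaSeq_tendsto_Gamma s).inv₀ h

lemma cse_desc_tendsto (k : ℕ) :
    Tendsto (fun n : ℕ => (n.descFactorial k : ℂ) / (n : ℂ) ^ k) atTop (𝓝 1) := by
  have h := isEquivalent_descFactorial k
  rw [Asymptotics.isEquivalent_iff_tendsto_one] at h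
  · have h2 := (Complex.continuous_ofReal.tendsto 1).comp h
    rw [Complex.ofReal_one] at h2
    refine h2.congr (fun n => ?_)
    simp
  · filter_upwards [eventually_ne_atTop 0] with n hn
    positivity

lemma cse_const_tendsto (u lam S : ℂ) (hδ : 0 < (lam + u - S).re) :
    Tendsto (fun n : ℕ => (n : ℂ) ^ (2 * S - 3 * u) * ∏ j ∈ range (n + 1), ((u + j - lam) / (j + lam)))
      atTop (𝓝 0) := by
  have h1 : Tendsto (fun n : ℕ => (n : ℂ) ^ (-(2 * (lam + u - S)))) atTop (𝓝 0) := by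
    rw [tendsto_zero_iff_norm_tendsto_zero]
    have h := (tendsto_rpow_neg_atTop (y := 2 * (lam + u - S).re) (by linarith)).comp
      (tendsto_natCast_atTop_atTop (R := ℝ))
    refine h.congr' ?_
    filter_upwards [eventually_gt_atTop 0] with n hn
    have hn0 : (0 : ℝ) < n := by exact_mod_cast hn
    rw [← Complex.ofReal_natCast, Complex.norm_cpow_eq_rpow_re_of_pos hn0]
    simp
  have h2 := (h1.mul (GammaSeq_tendsto_Gamma lam)).mul (cse_inv_tendsto (u - lam))
  rw [zero_mul, zero_mul] at h2
  refine h2.congr' ?_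
  filter_upwards [eventually_gt_atTop 0] with n hn
  have hn' : (n : ℂ) ≠ 0 := Nat.cast_ne_zero.mpr hn.ne'
  have hz : ∀ z : ℂ, (n : ℂ) ^ z ≠ 0 := fun z => by
    rw [Ne, cpow_eq_zero_iff]; tauto
  have e1 : -(2 * (lam + u - S)) = (2 * S - 3 * u) + (u - lam) - lam := by ring
  have h5 : (n.factorial : ℂ) ≠ 0 := Nat.cast_ne_zero.mpr n.factorial_ne_zero
  have h6 := hz lam
  have h7 := hz (u - lam)
  rw [e1, cpow_sub _ _ hn', cpow_add _ _ hn', GammaSeq, GammaSeq, Finset.prod_div_distrib, inv_div]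
  have e2 : ∏ j ∈ range (n + 1), (u - lam + (j : ℂ)) = ∏ j ∈ range (n + 1), (u + j - lam) :=
    Finset.prod_congr rfl (fun j _ => by ring)
  have e3 : ∏ j ∈ range (n + 1), (lam + (j : ℂ)) = ∏ j ∈ range (n + 1), (j + lam) :=
    Finset.prod_congr rfl (fun j _ => by ring)
  rw [e2, e3]
  field_simp

lemma cse_W_bound (x : ℂ) (hx : ∀ m : ℕ, x + m ≠ 0) :
    ∃ C : ℝ, 0 < C ∧ ∀ k : ℕ, ‖1 / (x + k)‖ ≤ C / ((k : ℝ) + 1) := by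
  obtain ⟨c, hc, h⟩ := cse_lower x hx
  refine ⟨1 / c, by positivity, fun k => ?_⟩
  rw [norm_div, norm_one, div_div]
  exact one_div_le_one_div_of_le (by positivity) (h k)

lemma cse_dom (u lam x₁ x₂ x₃ : ℂ)
    (hre : 0 < (lam + u - x₁ - x₂ - x₃).re) (ηp ηm : ℕ → ℂ)
    (hη : ∀ k : ℕ, ηp k + ηm k = x₁ + x₂ + x₃ + k
      ∧ (-(k : ℂ) - lam) * (ηp k - lam) * (ηm k - lam)
          = (x₁ - lam) * (x₂ - lam) * (x₃ - lam))
    (hx₁ : ∀ m : ℕ, x₁ + m ≠ 0) (hx₂ : ∀ m : ℕ, x₂ + m ≠ 0) (hx₃ : ∀ m : ℕ, x₃ + m ≠ 0)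
    (hlam : ∀ m : ℕ, lam + m ≠ 0)
    (hηp : ∀ k : ℕ, ∀ m : ℕ, ηp k + m ≠ 0) (hηm : ∀ k : ℕ, ∀ m : ℕ, ηm k + m ≠ 0) :
    ∃ k₁ : ℕ, ∃ B : ℕ → ℝ, Summable B ∧ ∀ k ≥ k₁, ∀ n : ℕ, n ≠ 0 →
      ‖((-1 : ℂ) ^ k / (k.factorial : ℂ)) * ((n.descFactorial k : ℂ) / (n : ℂ) ^ k)
        * (GammaSeq (ηp k) n * GammaSeq (ηm k) n
          / (GammaSeq (u + k) n * GammaSeq (u - ηp k) n * GammaSeq (u - ηm k) n))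
        * (1 / (x₁ + k) + 1 / (x₂ + k) + 1 / (x₃ + k) - 1 / (lam + k))‖ ≤ B k := by
  have hS : lam + u - x₁ - x₂ - x₃ = lam + u - (x₁ + x₂ + x₃) := by ring
  rw [hS] at hre
  set δ := (lam + u - (x₁ + x₂ + x₃)).re with hδ
  obtain ⟨C, ε₀, k₀, hC, hε₀, hcore⟩ := cse_core u lam (x₁ + x₂ + x₃) hre hlam
  obtain ⟨cl, hcl, hcl'⟩ := cse_lower lam hlam
  obtain ⟨w1, hw1, hw1'⟩ := cse_W_bound x₁ hx₁
  obtain ⟨w2, hw2, hw2'⟩ := cse_W_bound x₂ hx₂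
  obtain ⟨w3, hw3, hw3'⟩ := cse_W_bound x₃ hx₃
  obtain ⟨w4, hw4, hw4'⟩ := cse_W_bound lam hlam
  obtain ⟨k₂, hk₂⟩ := exists_nat_ge (‖(x₁ - lam) * (x₂ - lam) * (x₃ - lam)‖ / (cl * ε₀ ^ 2))
  refine ⟨max k₀ k₂, fun k => C * (w1 + w2 + w3 + w4) * (1 / ((k : ℝ) + 1) ^ (1 + δ)), ?_, ?_⟩
  · apply Summable.mul_left
    have := (summable_nat_add_iff 1).mpr (Real.summable_one_div_nat_rpow.mpr (show 1 < 1 + δ by linarith))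
    simpa using this
  intro k hk n hn
  have hkk₀ : k ≥ k₀ := (le_max_left _ _).trans hk
  have hkk₂ : k ≥ k₂ := (le_max_right _ _).trans hk
  rcases lt_or_ge n k with hnk | hkn
  · rw [Nat.descFactorial_of_lt hnk]
    simp
    positivity
  have hpa : ∏ j ∈ range (n + 1), (ηp k + j) ≠ 0 := Finset.prod_ne_zero_iff.mpr fun j _ => hηp k j
  have hpb : ∏ j ∈ range (n + 1), (ηm k + j) ≠ 0 := Finset.prod_ne_zero_iff.mpr fun j _ => hηm k j
  rw [cse_finite_term u (x₁ + x₂ + x₃) (ηp k) (ηm k) _ n k hn hkn (hη k).1 hpa hpb, norm_mul]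
  have hW : ‖1 / (x₁ + k) + 1 / (x₂ + k) + 1 / (x₃ + k) - 1 / (lam + k)‖ ≤
      (w1 + w2 + w3 + w4) / ((k : ℝ) + 1) := by
    refine (norm_sub_le _ _).trans ?_
    have h1 := norm_add₃_le (a := 1 / (x₁ + k)) (b := 1 / (x₂ + k)) (c := 1 / (x₃ + k))
    have h2 := hw1' k
    have h3 := hw2' k
    have h4 := hw3' k
    have h5 := hw4' k
    simp only [add_div]
    linarith
  have hsmall : ∀ a b : ℂ, (-(k : ℂ) - lam) * (a - lam) * (b - lam)
          = (x₁ - lam) * (x₂ - lam) * (x₃ - lam) → ‖b - lam‖ ≤ ‖a - lam‖ → ‖b - lam‖ ≤ ε₀ := by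
    intro a b h hab
    have h1 := congrArg norm h
    rw [norm_mul (_ * _), norm_mul, show -(k : ℂ) - lam = -(lam + k) by ring, norm_neg] at h1
    have h2 := hcl' k
    have hk3 : (k₂ : ℝ) ≤ k := by exact_mod_cast hkk₂
    have h3 : ‖(x₁ - lam) * (x₂ - lam) * (x₃ - lam)‖ ≤ (cl * (k + 1)) * ε₀ ^ 2 := by
      have := hk₂.trans hk3
      rw [div_le_iff₀ (by positivity)] at this
      have h5 : 0 ≤ cl * ε₀ ^ 2 := by positivity
      linarith
    have h4 : cl * (k + 1) * ‖b - lam‖ ^ 2 ≤ (cl * (k + 1)) * ε₀ ^ 2 := by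
      refine le_trans ?_ h3
      rw [← h1, sq, ← mul_assoc]
      gcongr
    have h6 : ‖b - lam‖ ^ 2 ≤ ε₀ ^ 2 := le_of_mul_le_mul_left h4 (by positivity)
    exact (abs_le_of_sq_le_sq' h6 hε₀.le).2
  have hexp : Real.exp (-δ * cseH k) ≤ 1 / ((k : ℝ) + 1) ^ δ := by
    have hp : (0 : ℝ) < (k : ℝ) + 1 := by positivity
    rw [one_div, ← Real.rpow_neg hp.le, Real.rpow_def_of_pos hp, Real.exp_le_exp]
    have := cseH_lower k
    nlinarith
  have hmain : ‖(n : ℂ) ^ (2 * (x₁ + x₂ + x₃) - 3 * u) * (((-1 : ℂ) ^ k / ((k.factorial : ℂ) * ((n - k).factorial : ℂ)))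
      * ((∏ j ∈ range (n + 1), (u + k + j)) * (∏ j ∈ range (n + 1), (u - ηp k + j))
        * (∏ j ∈ range (n + 1), (u - ηm k + j)) / ((∏ j ∈ range (n + 1), (ηp k + j)) *
          ∏ j ∈ range (n + 1), (ηm k + j))))‖ ≤ C * Real.exp (-δ * cseH k) := by
    rcases le_total ‖ηm k - lam‖ ‖ηp k - lam‖ with h | h
    · exact hcore k hkk₀ n hn hkn (ηp k) (ηm k) (hsmall _ _ (hη k).2 h) (hη k).1
    · have := hcore k hkk₀ n hn hkn (ηm k) (ηp k)
        (hsmall (ηm k) (ηp k) (by rw [← (hη k).2]; ring) h) (by rw [← (hη k).1]; ring)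
      rwa [mul_right_comm, mul_comm (∏ j ∈ range (n + 1), (ηm k + (j : ℂ)))] at this
  calc _ ≤ (C * (1 / ((k : ℝ) + 1) ^ δ)) * ((w1 + w2 + w3 + w4) / ((k : ℝ) + 1)) := by
        refine mul_le_mul (hmain.trans ?_) hW (norm_nonneg _) (by positivity)
        gcongr
    _ = _ := by
      have hp : (0 : ℝ) < (k : ℝ) + 1 := by positivity
      beta_reduce
      rw [Real.rpow_add hp, Real.rpow_one]
      field_simp

/-- Corollary 5.1: symmetric expansion of closed string amplitudes. -/
theorem closed_symmetric_expansion (u lam x₁ x₂ x₃ : ℂ)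
    (hre : 0 < (lam + u - x₁ - x₂ - x₃).re)
    (ηp ηm : ℕ → ℂ)
    (hη : ∀ k : ℕ, ηp k + ηm k = x₁ + x₂ + x₃ + k
      ∧ (-(k : ℂ) - lam) * (ηp k - lam) * (ηm k - lam)
          = (x₁ - lam) * (x₂ - lam) * (x₃ - lam))
    (hx₁ : ∀ m : ℕ, x₁ ≠ -(m : ℂ))
    (hx₂ : ∀ m : ℕ, x₂ ≠ -(m : ℂ))
    (hx₃ : ∀ m : ℕ, x₃ ≠ -(m : ℂ))
    (hlam : ∀ m : ℕ, lam ≠ -(m : ℂ))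
    (hu₁ : ∀ m : ℕ, u - x₁ ≠ -(m : ℂ))
    (hu₂ : ∀ m : ℕ, u - x₂ ≠ -(m : ℂ))
    (hu₃ : ∀ m : ℕ, u - x₃ ≠ -(m : ℂ))
    (hηp : ∀ k : ℕ, ∀ m : ℕ, ηp k ≠ -(m : ℂ))
    (hηm : ∀ k : ℕ, ∀ m : ℕ, ηm k ≠ -(m : ℂ)) :
    Tendsto (fun N : ℕ => ∑ k ∈ Finset.range N,
        ((-1 : ℂ) ^ k / (k.factorial : ℂ))
        * (Complex.Gamma (ηp k) * Complex.Gamma (ηm k)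
          / (Complex.Gamma (u + k) * Complex.Gamma (u - ηp k)
            * Complex.Gamma (u - ηm k)))
        * (1 / (x₁ + k) + 1 / (x₂ + k) + 1 / (x₃ + k) - 1 / (lam + k)))
      atTop
      (𝓝 (Complex.Gamma x₁ * Complex.Gamma x₂ * Complex.Gamma x₃
            / (Complex.Gamma (u - x₁) * Complex.Gamma (u - x₂)
              * Complex.Gamma (u - x₃)))) := by
  have hne : ∀ {x : ℂ}, (∀ m : ℕ, x ≠ -(m : ℂ)) → ∀ m : ℕ, x + m ≠ 0 := by
    intro x h m hm
    exact h m (eq_neg_of_add_eq_zero_left hm)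
  have gx₁ := hne hx₁
  have gx₂ := hne hx₂
  have gx₃ := hne hx₃
  have glam := hne hlam
  have gp := fun k => hne (hηp k)
  have gm := fun k => hne (hηm k)
  set T : ℕ → ℕ → ℂ := fun n k =>
      ((-1 : ℂ) ^ k / (k.factorial : ℂ)) * ((n.descFactorial k : ℂ) / (n : ℂ) ^ k)
        * (GammaSeq (ηp k) n * GammaSeq (ηm k) n
          / (GammaSeq (u + k) n * GammaSeq (u - ηp k) n * GammaSeq (u - ηm k) n))
        * (1 / (x₁ + k) + 1 / (x₂ + k) + 1 / (x₃ + k) - 1 / (lam + k)) with hT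
  set t : ℕ → ℂ := fun k => ((-1 : ℂ) ^ k / (k.factorial : ℂ))
        * (Complex.Gamma (ηp k) * Complex.Gamma (ηm k)
          / (Complex.Gamma (u + k) * Complex.Gamma (u - ηp k)
            * Complex.Gamma (u - ηm k)))
        * (1 / (x₁ + k) + 1 / (x₂ + k) + 1 / (x₃ + k) - 1 / (lam + k)) with ht
  have hlim : ∀ k, Tendsto (fun n => T n k) atTop (𝓝 (t k)) := by
    intro k
    have h := (((cse_desc_tendsto k).const_mul ((-1 : ℂ) ^ k / (k.factorial : ℂ))).mul
      (((GammaSeq_tendsto_Gamma (ηp k)).mul (GammaSeq_tendsto_Gamma (ηm k))).mul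
        (((cse_inv_tendsto (u + k)).mul (cse_inv_tendsto (u - ηp k))).mul
          (cse_inv_tendsto (u - ηm k))))).mul_const
        (1 / (x₁ + k) + 1 / (x₂ + k) + 1 / (x₃ + k) - 1 / (lam + k))
    simp only [← mul_inv, mul_one] at h
    simp only [← div_eq_mul_inv] at h
    exact h
  obtain ⟨k₁, B, hB, hdom⟩ := cse_dom u lam x₁ x₂ x₃ hre ηp ηm hη gx₁ gx₂ gx₃ glam gp gm
  set B' : ℕ → ℝ := fun k => if k < k₁ then ‖t k‖ + 1 else B k with hB'
  have hB's : Summable B' := by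
    refine (summable_nat_add_iff k₁).mp (((summable_nat_add_iff k₁).mpr hB).congr (fun k => ?_))
    simp [hB']
  have hbound : ∀ᶠ n in atTop, ∀ k, ‖T n k‖ ≤ B' k := by
    have h1 : ∀ᶠ n in atTop, ∀ k ∈ Finset.range k₁, ‖T n k‖ ≤ ‖t k‖ + 1 := by
      rw [Filter.eventually_all_finset]
      intro k _
      exact ((hlim k).norm.eventually_lt_const (lt_add_one _)).mono (fun n h => h.le)
    filter_upwards [h1, eventually_ne_atTop 0] with n hn1 hn0 k
    by_cases hk : k < k₁
    · simpa [hB', hk] using hn1 k (Finset.mem_range.mpr hk)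
    · simpa only [hB', hk, if_false] using hdom k (not_lt.mp hk) n hn0
  have htend := tendsto_tsum_of_dominated_convergence hB's hlim hbound
  have htb : ∀ k, ‖t k‖ ≤ B' k := fun k =>
    le_of_tendsto (hlim k).norm (hbound.mono (fun n h => h k))
  have hts : Summable t := Summable.of_norm_bounded hB's htb
  have hL : Tendsto (fun n => GammaSeq x₁ n * GammaSeq x₂ n * GammaSeq x₃ n /
      (GammaSeq (u - x₁) n * GammaSeq (u - x₂) n * GammaSeq (u - x₃) n)) atTop
      (𝓝 (Complex.Gamma x₁ * Complex.Gamma x₂ * Complex.Gamma x₃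
            / (Complex.Gamma (u - x₁) * Complex.Gamma (u - x₂)
              * Complex.Gamma (u - x₃)))) := by
    have h := (((GammaSeq_tendsto_Gamma x₁).mul (GammaSeq_tendsto_Gamma x₂)).mul
      (GammaSeq_tendsto_Gamma x₃)).mul (((cse_inv_tendsto (u - x₁)).mul (cse_inv_tendsto (u - x₂))).mul
          (cse_inv_tendsto (u - x₃)))
    simp only [← mul_inv] at h
    simp only [← div_eq_mul_inv] at h
    exact h
  have hS : lam + u - x₁ - x₂ - x₃ = lam + u - (x₁ + x₂ + x₃) := by ring
  have hR := (cse_const_tendsto u lam (x₁ + x₂ + x₃) (hS ▸ hre)).add htend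
  rw [zero_add] at hR
  have heq : (∑' k, t k) = Complex.Gamma x₁ * Complex.Gamma x₂ * Complex.Gamma x₃
            / (Complex.Gamma (u - x₁) * Complex.Gamma (u - x₂)
              * Complex.Gamma (u - x₃)) := by
    refine tendsto_nhds_unique hR (hL.congr' ?_)
    filter_upwards [eventually_ne_atTop 0] with n hn
    rw [cse_finite u lam x₁ x₂ x₃ ηp ηm hη gx₁ gx₂ gx₃ glam gp gm n hn]
    congr 1
    symm
    refine tsum_eq_sum (fun k hk => ?_)
    have : n < k := by rw [Finset.mem_range] at hk; omega
    simp [hT, Nat.descFactorial_of_lt this]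
  rw [← heq]
  exact hts.hasSum.tendsto_sum_nat
end

section
/- Let a ∈ ℤ and let λ, x₁, x₂, x₃ ∈ ℂ with s := x₁ + x₂ + x₃ and Re(λ + a) > 0. For each integer k ≥ 0 let η_k^+, η_k^− ∈ ℂ be any numbers satisfying η_k^+ + η_k^− = s + k and (−k − λ)(η_k^+ − λ)(η_k^− − λ) = (x₁−λ)(x₂−λ)(x₃−λ). Assume x₁, x₂, x₃ and λ are not nonpositive integers, a + s − x₁, a + s − x₂, a + s − x₃ and a + s are not nonpositive integers, and η_k^+, η_k^− are not nonpositive integers for all k ≥ 0. Then the series ∑_{k=0}^{∞} [ (−1)^k / k! ] · [ (1 − η_k^+)_{k−a} (1 − η_k^−)_{k−a} / (a+s)_k ] · ( 1/(x₁+k) + 1/(x₂+k) + 1/(x₃+k) − 1/(λ+k) ) converges and its sum equals Γ(x₁)Γ(x₂)Γ(x₃)Γ(a+s) / ( Γ(a+s−x₁)Γ(a+s−x₂)Γ(a+s−x₃) ). -/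
open Finset Filter Topology Complex

/-- The Pochhammer symbol `(z)_k = z(z+1)⋯(z+k-1)`, with `(z)_0 = 1`. -/
noncomputable def poch (z : ℂ) (k : ℕ) : ℂ := ∏ j ∈ Finset.range k, (z + j)

/-- The generalized Pochhammer symbol `(z)_m` for integer `m`:
`(z)_m = z(z+1)⋯(z+m-1)` for `m ≥ 0` and
`(z)_m = 1/((z-1)(z-2)⋯(z+m))` for `m < 0`. -/
noncomputable def gpoch (z : ℂ) (m : ℤ) : ℂ :=
  if 0 ≤ m then ∏ j ∈ Finset.range m.toNat, (z + j)
  else (∏ j ∈ Finset.range (-m).toNat, (z - 1 - j))⁻¹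



theorem hseq_tendsto (z : ℂ) : Tendsto (fun n : ℕ => (∏ j ∈ Finset.range n, (z + j)) /
    ((n.factorial : ℂ) * ((n : ℂ) + 1) ^ (z - 1))) atTop (𝓝 (Complex.Gamma z)⁻¹) := by
  by_cases hz : ∃ m : ℕ, z = -(m : ℂ)
  · obtain ⟨m, rfl⟩ := hz
    rw [Complex.Gamma_neg_nat_eq_zero, inv_zero]
    apply tendsto_const_nhds.congr'
    filter_upwards [eventually_gt_atTop m] with n hn
    rw [Finset.prod_eq_zero (Finset.mem_range.2 hn) (by simp), zero_div]
  · push Not at hz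
    have h1 := ((Complex.GammaSeq_tendsto_Gamma z).comp (tendsto_add_atTop_nat 1)).inv₀
      (Complex.Gamma_ne_zero hz)
    have hl : ∀ c : ℂ, Tendsto (fun n : ℕ => ((n : ℂ) + 1) / (c + n)) atTop (𝓝 1) := by
      intro c
      have := tendsto_add_mul_div_add_mul_atTop_nhds (𝕜 := ℂ) 1 c 1 one_ne_zero
      simp only [one_mul, div_one] at this
      refine this.congr fun n => by ring_nf
    have h2 := (h1.mul (hl z)).mul (hl (z + 1))
    rw [mul_one, mul_one] at h2
    refine h2.congr fun n => ?_
    have hzn : z + n ≠ 0 := fun h => hz n (eq_neg_of_add_eq_zero_left h)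
    have hzn1 : z + 1 + n ≠ 0 := fun h => hz (n + 1) (by push_cast; linear_combination h)
    have hn1 : (n : ℂ) + 1 ≠ 0 := Nat.cast_add_one_ne_zero n
    have hp : ((n : ℂ) + 1) ^ (z - 1) ≠ 0 := by rw [Ne, Complex.cpow_eq_zero_iff]; tauto
    have hf : (n.factorial : ℂ) ≠ 0 := Nat.cast_ne_zero.2 (Nat.factorial_ne_zero n)
    have hpz : ((n : ℂ) + 1) ^ z = ((n : ℂ) + 1) ^ (z - 1) * (n + 1) := by
      rw [Complex.cpow_sub _ _ hn1, Complex.cpow_one]; field_simp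
    simp only [Function.comp_apply, Complex.GammaSeq, Finset.prod_range_succ, Nat.factorial_succ]
    push_cast
    rw [hpz]
    have : z + (↑n + 1) ≠ 0 := by rwa [show z + ((n : ℂ) + 1) = z + 1 + n by ring]
    field_simp
    ring

theorem norm_cpow_nat1 (n : ℕ) (z : ℂ) : ‖((n : ℂ) + 1) ^ z‖ = ((n : ℝ) + 1) ^ z.re := by
  have := Complex.norm_cpow_eq_rpow_re_of_pos (x := (n : ℝ) + 1) (by positivity) z
  push_cast at this
  exact this

theorem bdd_of_tendsto_pos (u : ℕ → ℝ) (hu : ∀ n, 0 < u n) (l : ℝ) (hl : 0 < l)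
    (h : Tendsto u atTop (𝓝 l)) : ∃ c > 0, ∃ C > 0, ∀ n, c ≤ u n ∧ u n ≤ C := by
  obtain ⟨C, hC⟩ := h.bddAbove_range
  obtain ⟨D, hD⟩ := (h.inv₀ hl.ne').bddAbove_range
  have h1 : ∀ n, u n ≤ C := fun n => hC ⟨n, rfl⟩
  have h2 : ∀ n, (u n)⁻¹ ≤ D := fun n => hD ⟨n, rfl⟩
  have hD0 : 0 < D := (inv_pos.2 (hu 0)).trans_le (h2 0)
  refine ⟨D⁻¹, inv_pos.2 hD0, C, (hu 0).trans_le (h1 0), fun n => ⟨?_, h1 n⟩⟩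
  exact inv_le_of_inv_le₀ (hu n) (h2 n)

theorem prod_bounds (z : ℂ) (hz : ∀ m : ℕ, z ≠ -(m : ℂ)) : ∃ c > 0, ∃ C > 0, ∀ n : ℕ,
    c * ((n.factorial : ℝ) * ((n : ℝ) + 1) ^ (z.re - 1)) ≤ ∏ j ∈ Finset.range n, ‖z + j‖ ∧
    ∏ j ∈ Finset.range n, ‖z + j‖ ≤ C * ((n.factorial : ℝ) * ((n : ℝ) + 1) ^ (z.re - 1)) := by
  have key : ∀ n : ℕ, ‖(∏ j ∈ Finset.range n, (z + j)) /
    ((n.factorial : ℂ) * ((n : ℂ) + 1) ^ (z - 1))‖ = (∏ j ∈ Finset.range n, ‖z + j‖) /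
      ((n.factorial : ℝ) * ((n : ℝ) + 1) ^ (z.re - 1)) := by
    intro n
    rw [norm_div, norm_mul, norm_prod, norm_cpow_nat1]
    simp
  have hpos : ∀ n : ℕ, 0 < (n.factorial : ℝ) * ((n : ℝ) + 1) ^ (z.re - 1) := fun n => by positivity
  obtain ⟨c, hc, C, hC, h⟩ := bdd_of_tendsto_pos _ (fun n => by
      rw [key n]
      refine div_pos (Finset.prod_pos fun j _ => norm_pos_iff.2 fun h => hz j (eq_neg_of_add_eq_zero_left h)) (hpos n))
    _ (norm_pos_iff.2 (inv_ne_zero (Complex.Gamma_ne_zero hz))) (hseq_tendsto z).norm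
  refine ⟨c, hc, C, hC, fun n => ?_⟩
  obtain ⟨h1, h2⟩ := h n
  rw [key n] at h1 h2
  exact ⟨(le_div_iff₀ (hpos n)).1 h1, (div_le_iff₀ (hpos n)).1 h2⟩

theorem exists_reg (z : ℂ) : ∃ z' : ℂ, z'.re = z.re ∧ (∀ m : ℕ, z' ≠ -(m : ℂ)) ∧
    (∀ t : ℝ, ‖z + t‖ ≤ ‖z' + t‖) ∧ ∃ C > 0, ∀ t : ℝ, ‖z' + t‖ ^ 2 ≤ ‖z + t‖ ^ 2 + C := by
  rcases le_total 0 z.im with h | h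
  · refine ⟨z + I, by simp, ?_, ?_, 2 * z.im + 1, by positivity, ?_⟩
    · intro m hm
      have := congrArg Complex.im hm
      simp at this; linarith
    · intro t
      rw [← sq_le_sq₀ (norm_nonneg _) (norm_nonneg _), Complex.sq_norm, Complex.sq_norm,
        Complex.normSq_apply, Complex.normSq_apply]
      simp; nlinarith
    · intro t
      rw [Complex.sq_norm, Complex.sq_norm,
        Complex.normSq_apply, Complex.normSq_apply]
      simp; nlinarith
  · refine ⟨z - I, by simp, ?_, ?_, -2 * z.im + 1, by linarith, ?_⟩
    · intro m hm
      have := congrArg Complex.im hm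
      simp at this; linarith
    · intro t
      rw [← sq_le_sq₀ (norm_nonneg _) (norm_nonneg _), Complex.sq_norm, Complex.sq_norm,
        Complex.normSq_apply, Complex.normSq_apply]
      simp; nlinarith
    · intro t
      rw [Complex.sq_norm, Complex.sq_norm,
        Complex.normSq_apply, Complex.normSq_apply]
      simp; nlinarith

/-- linear lower bound -/
theorem lin_lower (z : ℂ) (hz : ∀ m : ℕ, z ≠ -(m : ℂ)) : ∃ c > 0, ∀ n : ℕ,
    c * ((n : ℝ) + 1) ≤ ‖z + n‖ := by
  have hl : Tendsto (fun n : ℕ => (z + n) / ((n : ℂ) + 1)) atTop (𝓝 1) := by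
    have := tendsto_add_mul_div_add_mul_atTop_nhds (𝕜 := ℂ) z 1 1 one_ne_zero
    simp only [one_mul, div_one] at this
    refine this.congr fun n => by ring_nf
  have e : ∀ n : ℕ, ‖(z + n) / ((n : ℂ) + 1)‖ = ‖z + n‖ / ((n : ℝ) + 1) := fun n => by
    rw [norm_div]; congr 1; exact_mod_cast Complex.norm_natCast (n + 1)
  obtain ⟨c, hc, C, hC, h⟩ := bdd_of_tendsto_pos _ (fun n => by
      rw [e n]
      exact div_pos (norm_pos_iff.2 fun h => hz n (eq_neg_of_add_eq_zero_left h)) (by positivity))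
    _ (by simp) hl.norm
  refine ⟨c, hc, fun n => ?_⟩
  have := (h n).1
  rw [e n] at this
  exact (le_div_iff₀ (by positivity)).1 this


theorem cubic_at_node (lam x₁ x₂ x₃ k p m t : ℂ) (hkl : k + lam ≠ 0)
    (h1 : p + m = x₁ + x₂ + x₃ + k)
    (h2 : (-k - lam) * (p - lam) * (m - lam) = (x₁ - lam) * (x₂ - lam) * (x₃ - lam)) :
    (t + k) * (t - p) * (t - m) = (t - x₁) * (t - x₂) * (t - x₃)
      + (-((x₁ + k) * (x₂ + k) * (x₃ + k)) / (k + lam)) * (lam - t) * (-1) := by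
  have hm : m = x₁ + x₂ + x₃ + k - p := by linear_combination h1
  subst hm
  field_simp
  linear_combination (-k - t) * h2

theorem bracket_eq (lam x₁ x₂ x₃ k p m : ℂ) (hkl : lam + k ≠ 0)
    (hx₁ : x₁ + k ≠ 0) (hx₂ : x₂ + k ≠ 0) (hx₃ : x₃ + k ≠ 0)
    (h1 : p + m = x₁ + x₂ + x₃ + k)
    (h2 : (-k - lam) * (p - lam) * (m - lam) = (x₁ - lam) * (x₂ - lam) * (x₃ - lam)) :
    1 / (x₁ + k) + 1 / (x₂ + k) + 1 / (x₃ + k) - 1 / (lam + k)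
      = (k + p) * (k + m) / ((x₁ + k) * (x₂ + k) * (x₃ + k)) := by
  have hm : m = x₁ + x₂ + x₃ + k - p := by linear_combination h1
  subst hm
  field_simp
  linear_combination h2

open Polynomial in
theorem lagrange_zero (N : ℕ) (w : ℕ → ℂ) (hw : Set.InjOn w (Finset.range (N + 1)))
    (α β : ℕ → ℂ) :
    ∏ j ∈ Finset.range N, α j = ∑ k ∈ Finset.range (N + 1),
      (∏ j ∈ Finset.range N, (α j + w k * β j)) *
        ∏ j ∈ (Finset.range (N + 1)).erase k, ((w k - w j)⁻¹ * (0 - w j)) := by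
  set f : ℂ[X] := ∏ j ∈ Finset.range N, (C (α j) + X * C (β j)) with hf
  have hdeg : f.degree < #(Finset.range (N + 1)) := by
    rw [hf]
    refine lt_of_le_of_lt (Polynomial.degree_prod_le _ _) ?_
    refine lt_of_le_of_lt (Finset.sum_le_card_nsmul _ _ 1 ?_) ?_
    · intro j _
      compute_degree
    · simp only [Finset.card_range, nsmul_eq_mul, mul_one]
      exact_mod_cast Nat.lt_succ_self N
  have h := congrArg (Polynomial.eval 0) (Lagrange.eq_interpolate hw hdeg)
  rw [Lagrange.interpolate_apply, Polynomial.eval_finsetSum] at h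
  simp only [hf, Polynomial.eval_prod, Polynomial.eval_add, Polynomial.eval_C, Polynomial.eval_mul,
    Polynomial.eval_X, zero_mul, add_zero, Lagrange.basis, Lagrange.basisDivisor,
    Polynomial.eval_sub] at h
  exact h

noncomputable def Tm (A s x₁ x₂ x₃ : ℂ) (ηp ηm : ℕ → ℂ) (N k : ℕ) : ℂ :=
  ((N : ℂ) + 1) ^ (3 - 3 * A - s) *
    (∏ j ∈ Finset.range N, ((A + s + k + j) * (A + ηp k - k + j) * (A + ηm k - k + j))) /
    ((∏ j ∈ (Finset.range (N + 1)).erase k, (((j : ℂ) - k) * (j + ηp k) * (j + ηm k)))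
      * ((x₁ + k) * (x₂ + k) * (x₃ + k)))

theorem sum_Tm (A lam x₁ x₂ x₃ s : ℂ)
    (hs : s = x₁ + x₂ + x₃)
    (ηp ηm : ℕ → ℂ)
    (hη : ∀ k : ℕ, ηp k + ηm k = s + k
      ∧ (-(k : ℂ) - lam) * (ηp k - lam) * (ηm k - lam)
          = (x₁ - lam) * (x₂ - lam) * (x₃ - lam))
    (hx₁ : ∀ m : ℕ, x₁ ≠ -(m : ℂ))
    (hx₂ : ∀ m : ℕ, x₂ ≠ -(m : ℂ))
    (hx₃ : ∀ m : ℕ, x₃ ≠ -(m : ℂ))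
    (hlam : ∀ m : ℕ, lam ≠ -(m : ℂ))
    (hηp : ∀ k : ℕ, ∀ m : ℕ, ηp k ≠ -(m : ℂ))
    (hηm : ∀ k : ℕ, ∀ m : ℕ, ηm k ≠ -(m : ℂ)) (N : ℕ) :
    ∑ k ∈ Finset.range (N + 1), Tm A s x₁ x₂ x₃ ηp ηm N k =
      ((N : ℂ) + 1) ^ (3 - 3 * A - s) *
      (∏ j ∈ Finset.range N, ((A + s - x₁ + j) * (A + s - x₂ + j) * (A + s - x₃ + j))) /
      ∏ j ∈ Finset.range (N + 1), ((x₁ + j) * (x₂ + j) * (x₃ + j)) := by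
  have hl0 : ∀ k : ℕ, (k : ℂ) + lam ≠ 0 := fun k h => hlam k (by linear_combination h)
  have h10 : ∀ k : ℕ, x₁ + k ≠ 0 := fun k h => hx₁ k (by linear_combination h)
  have h20 : ∀ k : ℕ, x₂ + k ≠ 0 := fun k h => hx₂ k (by linear_combination h)
  have h30 : ∀ k : ℕ, x₃ + k ≠ 0 := fun k h => hx₃ k (by linear_combination h)
  have hp0 : ∀ k j : ℕ, (j : ℂ) + ηp k ≠ 0 := fun k j h => hηp k j (by linear_combination h)
  have hm0 : ∀ k j : ℕ, (j : ℂ) + ηm k ≠ 0 := fun k j h => hηm k j (by linear_combination h)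
  set Q : ℕ → ℂ := fun k => (x₁ + k) * (x₂ + k) * (x₃ + k) with hQ
  have hQ0 : ∀ k, Q k ≠ 0 := fun k => mul_ne_zero (mul_ne_zero (h10 k) (h20 k)) (h30 k)
  set w : ℕ → ℂ := fun k => -(Q k) / (k + lam) with hw
  have cub : ∀ (k : ℕ) (t : ℂ), (t + k) * (t - ηp k) * (t - ηm k) =
      (t - x₁) * (t - x₂) * (t - x₃) + w k * (t - lam) := by
    intro k t
    have := cubic_at_node lam x₁ x₂ x₃ k (ηp k) (ηm k) t (hl0 k) (by rw [(hη k).1, hs]) (hη k).2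
    rw [this]; ring
  have wsub : ∀ k j : ℕ, (w k - w j) * (j + lam) = ((j : ℂ) - k) * (j + ηp k) * (j + ηm k) := by
    intro k j
    have := cub k (-(j : ℂ))
    have hwj : w j * (j + lam) = - Q j := by rw [hw]; field_simp [hl0 j]
    rw [hQ] at hwj
    simp only at hwj
    linear_combination this - hwj
  have wne : ∀ k j : ℕ, j ≠ k → w k - w j ≠ 0 := by
    intro k j hjk h0
    have := wsub k j
    rw [h0, zero_mul] at this
    refine mul_ne_zero (mul_ne_zero ?_ (hp0 k j)) (hm0 k j) this.symm
    rw [sub_ne_zero]; exact_mod_cast hjk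
  have inj : Set.InjOn w (Finset.range (N + 1)) := by
    intro k _ j _ hkj
    by_contra hne
    exact wne k j (Ne.symm hne) (sub_eq_zero.2 hkj)
  have L := lagrange_zero N w inj (fun j => (A + s - x₁ + j) * (A + s - x₂ + j) * (A + s - x₃ + j))
    (fun j => A + s + j - lam)
  rw [L, Finset.mul_sum, Finset.sum_div]
  refine Finset.sum_congr rfl fun k hk => ?_
  rw [Tm, ← Finset.mul_prod_erase _ _ hk]
  have e1 : ∏ j ∈ Finset.range N, ((A + s + k + j) * (A + ηp k - k + j) * (A + ηm k - k + j)) =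
      ∏ j ∈ Finset.range N, ((A + s - x₁ + j) * (A + s - x₂ + j) * (A + s - x₃ + j)
        + w k * (A + s + j - lam)) := by
    refine Finset.prod_congr rfl fun j _ => ?_
    have c := cub k (A + s + j)
    have e := (hη k).1
    have e' : A + ηp k - k + j = A + s + j - ηm k := by linear_combination e
    have e'' : A + ηm k - k + j = A + s + j - ηp k := by linear_combination e
    rw [e', e'']
    linear_combination c
  have e2 : ∏ j ∈ (Finset.range (N + 1)).erase k, ((w k - w j)⁻¹ * (0 - w j)) =
      (∏ j ∈ (Finset.range (N + 1)).erase k, ((x₁ + j) * (x₂ + j) * (x₃ + j))) /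
      (∏ j ∈ (Finset.range (N + 1)).erase k, (((j : ℂ) - k) * (j + ηp k) * (j + ηm k))) := by
    rw [← Finset.prod_div_distrib]
    refine Finset.prod_congr rfl fun j hj => ?_
    have hjk := Finset.ne_of_mem_erase hj
    rw [← wsub k j]
    have := wne k j hjk
    have h3 := hl0 j
    rw [show 0 - w j = Q j / (j + lam) by rw [hw]; ring]
    field_simp
    rfl
  rw [e1, e2]
  have hE : ∏ j ∈ (Finset.range (N + 1)).erase k, ((x₁ + j) * (x₂ + j) * (x₃ + j)) ≠ 0 :=
    Finset.prod_ne_zero_iff.2 fun j _ => hQ0 j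
  have hE2 : ∏ j ∈ (Finset.range (N + 1)).erase k, (((j : ℂ) - k) * (j + ηp k) * (j + ηm k)) ≠ 0 :=
    Finset.prod_ne_zero_iff.2 fun j hj => mul_ne_zero (mul_ne_zero
      (by rw [sub_ne_zero]; exact_mod_cast Finset.ne_of_mem_erase hj) (hp0 k j)) (hm0 k j)
  have a1 := h10 k
  have a2 := h20 k
  have a3 := h30 k
  generalize ∏ j ∈ (Finset.range (N + 1)).erase k, ((x₁ + (j:ℂ)) * (x₂ + j) * (x₃ + j)) = E at *
  generalize ∏ j ∈ (Finset.range (N + 1)).erase k, (((j : ℂ) - k) * (j + ηp k) * (j + ηm k)) = E' at *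
  field_simp

theorem prod_erase_split {R : Type*} [CommMonoid R] (f : ℕ → R) (k M : ℕ) :
    ∏ j ∈ (Finset.range (k + M + 1)).erase k, f j =
      (∏ j ∈ Finset.range k, f j) * ∏ j ∈ Finset.range M, f (k + 1 + j) := by
  set g := Function.update f k 1 with hg
  have e1 : ∏ j ∈ (Finset.range (k + M + 1)).erase k, f j =
      ∏ j ∈ (Finset.range (k + M + 1)).erase k, g j :=
    Finset.prod_congr rfl fun j hj => by
      rw [hg, Function.update_of_ne (Finset.ne_of_mem_erase hj)]
  rw [e1, Finset.prod_erase _ (by simp [hg]), show k + M + 1 = k + 1 + M by ring,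
    Finset.prod_range_add, Finset.prod_range_succ]
  congr 1
  · rw [show g k = 1 by simp [hg], mul_one]
    refine Finset.prod_congr rfl fun j hj => ?_
    rw [hg, Function.update_of_ne (Finset.mem_range.1 hj).ne]
  · refine Finset.prod_congr rfl fun j hj => ?_
    rw [hg, Function.update_of_ne (by omega)]

theorem prod_sub_neg (k : ℕ) : ∏ j ∈ Finset.range k, ((j : ℂ) - k) = (-1) ^ k * k.factorial := by
  rw [← Finset.prod_range_reflect, ← Finset.prod_range_add_one_eq_factorial]
  push_cast
  conv_rhs => rw [← Finset.card_range k, ← Finset.prod_const, Finset.card_range,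
    ← Finset.prod_mul_distrib]
  refine Finset.prod_congr rfl fun j hj => ?_
  have : j + 1 ≤ k := Finset.mem_range.1 hj
  rw [show k - 1 - j = k - (j + 1) by omega, Nat.cast_sub this]
  push_cast; ring

theorem prod_erase_sub (k M : ℕ) : ∏ j ∈ (Finset.range (k + M + 1)).erase k, ((j : ℂ) - k) =
    (-1) ^ k * k.factorial * M.factorial := by
  rw [prod_erase_split, prod_sub_neg, ← Finset.prod_range_add_one_eq_factorial M]
  push_cast
  congr 1
  refine Finset.prod_congr rfl fun j hj => ?_
  ring

theorem Gamma_inv_poch (z : ℂ) (n : ℕ) :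
    (Complex.Gamma z)⁻¹ = (∏ j ∈ Finset.range n, (z + j)) * (Complex.Gamma (z + n))⁻¹ := by
  induction n with
  | zero => simp
  | succ n ih =>
    rw [ih, Finset.prod_range_succ, mul_assoc]
    have := Complex.one_div_Gamma_eq_self_mul_one_div_Gamma_add_one (z + n)
    rw [this]
    push_cast
    rw [add_assoc]

theorem Gamma_gpoch (η : ℂ) (hη : ∀ m : ℕ, η ≠ -(m : ℂ)) (m : ℤ) :
    Complex.Gamma η * (Complex.Gamma (η - m))⁻¹ = (-1) ^ m * gpoch (1 - η) m := by
  have hG := Complex.Gamma_ne_zero hη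
  rcases le_or_gt 0 m with hm | hm
  · obtain ⟨n, rfl⟩ := Int.eq_ofNat_of_zero_le hm
    rw [gpoch, if_pos hm, Gamma_inv_poch _ n]
    simp only [Int.toNat_natCast, Int.cast_natCast, sub_add_cancel, zpow_natCast]
    rw [mul_comm, mul_assoc, inv_mul_cancel₀ hG, mul_one]
    conv_rhs => rw [← Finset.card_range n, ← Finset.prod_const, Finset.card_range,
      ← Finset.prod_range_reflect (fun j => 1 - η + (j : ℂ)), ← Finset.prod_mul_distrib]
    refine Finset.prod_congr rfl fun j hj => ?_
    have : j + 1 ≤ n := Finset.mem_range.1 hj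
    rw [show n - 1 - j = n - (j + 1) by omega, Nat.cast_sub this]
    push_cast; ring
  · obtain ⟨n, hn⟩ := Int.eq_ofNat_of_zero_le (a := -m) (by omega)
    obtain rfl : m = -(n : ℤ) := by omega
    rw [gpoch, if_neg (by omega)]
    simp only [neg_neg, Int.toNat_natCast, Int.cast_neg, Int.cast_natCast, sub_neg_eq_add,
      zpow_neg, zpow_natCast]
    have h := Gamma_inv_poch η n
    have hP : (∏ j ∈ Finset.range n, (1 - η - 1 - (j : ℂ))) =
        (-1) ^ n * ∏ j ∈ Finset.range n, (η + j) := by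
      conv_rhs => rw [← Finset.card_range n, ← Finset.prod_const, Finset.card_range,
        ← Finset.prod_mul_distrib]
      refine Finset.prod_congr rfl fun j hj => ?_
      ring
    have hne : ∏ j ∈ Finset.range n, (η + (j : ℂ)) ≠ 0 :=
      Finset.prod_ne_zero_iff.2 fun j _ hh => hη j (eq_neg_of_add_eq_zero_left hh)
    rw [hP, mul_inv, ← mul_assoc, ← mul_inv, ← mul_pow]
    simp only [mul_neg, mul_one, neg_neg, one_pow, inv_one, one_mul]
    refine eq_inv_of_mul_eq_one_left ?_
    have : Complex.Gamma η * (Complex.Gamma η)⁻¹ = 1 := mul_inv_cancel₀ hG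
    rw [h] at this
    linear_combination this

theorem descFact_tendsto (k : ℕ) : Tendsto (fun N : ℕ => (N.factorial : ℂ) /
    ((N - k).factorial * ((N : ℂ) + 1) ^ k)) atTop (𝓝 1) := by
  have h : Tendsto (fun N : ℕ => ∏ i ∈ Finset.range k, (((N : ℂ) - i) / (N + 1))) atTop
      (𝓝 (∏ i ∈ Finset.range k, (1 : ℂ))) := by
    refine tendsto_finsetProd _ fun i _ => ?_
    have := tendsto_add_mul_div_add_mul_atTop_nhds (𝕜 := ℂ) (-i) 1 1 one_ne_zero
    simp only [one_mul, div_one] at this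
    refine this.congr fun n => by ring_nf
  rw [Finset.prod_const_one] at h
  refine h.congr' ?_
  filter_upwards [eventually_ge_atTop k] with N hN
  rw [Finset.prod_div_distrib, Finset.prod_const, Finset.card_range]
  have h1 : (N.factorial : ℂ) = (N - k).factorial * ∏ i ∈ Finset.range k, ((N : ℂ) - i) := by
    rw [← Nat.factorial_mul_descFactorial hN, Nat.descFactorial_eq_prod_range]
    push_cast
    congr 1
    refine Finset.prod_congr rfl fun j hj => ?_
    rw [Nat.cast_sub ((Finset.mem_range.1 hj).le.trans hN)]
  rw [h1]
  have : ((N - k).factorial : ℂ) ≠ 0 := Nat.cast_ne_zero.2 (Nat.factorial_ne_zero _)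
  have hn1 : (N : ℂ) + 1 ≠ 0 := Nat.cast_add_one_ne_zero N
  field_simp

noncomputable def Hs (z : ℂ) (n : ℕ) : ℂ := (∏ j ∈ Finset.range n, (z + j)) /
    ((n.factorial : ℂ) * ((n : ℂ) + 1) ^ (z - 1))

theorem prod_eq_Hs (z : ℂ) (n : ℕ) : (∏ j ∈ Finset.range n, (z + j)) =
    Hs z n * ((n.factorial : ℂ) * ((n : ℂ) + 1) ^ (z - 1)) := by
  have hn1 : (n : ℂ) + 1 ≠ 0 := Nat.cast_add_one_ne_zero n
  have hp : ((n : ℂ) + 1) ^ (z - 1) ≠ 0 := by rw [Ne, Complex.cpow_eq_zero_iff]; tauto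
  have hf : (n.factorial : ℂ) ≠ 0 := Nat.cast_ne_zero.2 (Nat.factorial_ne_zero n)
  rw [Hs]; field_simp

theorem Hs_ne_zero (z : ℂ) (hz : ∀ m : ℕ, z ≠ -(m : ℂ)) (n : ℕ) : Hs z n ≠ 0 := by
  intro h
  have := prod_eq_Hs z n
  rw [h, zero_mul, Finset.prod_eq_zero_iff] at this
  obtain ⟨j, _, hj⟩ := this
  exact hz j (eq_neg_of_add_eq_zero_left hj)

theorem ratio_tendsto (c : ℂ) : Tendsto (fun n : ℕ => ((n : ℂ) + 1) / (c + n)) atTop (𝓝 1) := by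
  have := tendsto_add_mul_div_add_mul_atTop_nhds (𝕜 := ℂ) 1 c 1 one_ne_zero
  simp only [one_mul, div_one] at this
  refine this.congr fun n => by ring_nf

theorem Tm_eq (A s x₁ x₂ x₃ : ℂ) (ηp ηm : ℕ → ℂ) (N k : ℕ) (hk : k ≤ N)
    (hsum : ηp k + ηm k = s + k)
    (hηp : ∀ m : ℕ, ηp k ≠ -(m : ℂ))
    (hηm : ∀ m : ℕ, ηm k ≠ -(m : ℂ)) :
    Tm A s x₁ x₂ x₃ ηp ηm N k = (-1) ^ k / k.factorial *
      ((N.factorial : ℂ) / ((N - k).factorial * ((N : ℂ) + 1) ^ k)) *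
      (Hs (A + s + k) N * Hs (A + ηp k - k) N * Hs (A + ηm k - k) N * (Hs (ηp k) N)⁻¹ *
        (Hs (ηm k) N)⁻¹) * (((N : ℂ) + 1) / (ηp k + N)) * (((N : ℂ) + 1) / (ηm k + N)) *
      ((k + ηp k) * (k + ηm k) / ((x₁ + k) * (x₂ + k) * (x₃ + k))) := by
  have hp0 : ∀ j : ℕ, (j : ℂ) + ηp k ≠ 0 := fun j h => hηp j (by linear_combination h)
  have hm0 : ∀ j : ℕ, (j : ℂ) + ηm k ≠ 0 := fun j h => hηm j (by linear_combination h)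
  have hn1 : (N : ℂ) + 1 ≠ 0 := Nat.cast_add_one_ne_zero N
  have E : ∏ j ∈ (Finset.range (N + 1)).erase k, (((j : ℂ) - k) * (j + ηp k) * (j + ηm k)) =
      (-1) ^ k * k.factorial * (N - k).factorial *
      ((∏ j ∈ Finset.range N, (ηp k + j)) * (ηp k + N)) / (k + ηp k) *
      ((∏ j ∈ Finset.range N, (ηm k + j)) * (ηm k + N)) / (k + ηm k) := by
    rw [← Finset.prod_range_succ (fun j : ℕ => ηp k + j), ← Finset.prod_range_succ (fun j : ℕ => ηm k + j),
      Finset.prod_mul_distrib, Finset.prod_mul_distrib,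
      ← Finset.mul_prod_erase _ _ (Finset.mem_range.2 (Nat.lt_succ_of_le hk)),
      ← Finset.mul_prod_erase (Finset.range (N+1)) (fun j : ℕ => ηm k + j) (Finset.mem_range.2 (Nat.lt_succ_of_le hk))]
    obtain ⟨M, rfl⟩ := Nat.exists_eq_add_of_le hk
    rw [prod_erase_sub, Nat.add_sub_cancel_left]
    have h1 := hp0 k
    have h2 := hm0 k
    simp only [add_comm (ηp k), add_comm (ηm k)]
    field_simp
  have cp : ((N : ℂ) + 1) ^ (3 - 3 * A - s) * ((N : ℂ) + 1) ^ (A + s + k - 1) *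
      ((N : ℂ) + 1) ^ (A + ηp k - k - 1) * ((N : ℂ) + 1) ^ (A + ηm k - k - 1) *
      ((N : ℂ) + 1) ^ k = ((N : ℂ) + 1) ^ (ηp k - 1) * ((N : ℂ) + 1) ^ (ηm k - 1)
        * ((N : ℂ) + 1) ^ 2 := by
    rw [← Complex.cpow_natCast _ k, ← Complex.cpow_natCast _ 2]
    simp only [← Complex.cpow_add _ _ hn1]
    congr 1
    push_cast
    linear_combination (0 : ℂ) * hsum
  rw [Tm, E, Finset.prod_mul_distrib, Finset.prod_mul_distrib]
  simp only [prod_eq_Hs _ N]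
  have a1 := Hs_ne_zero _ hηp N
  have a2 := Hs_ne_zero _ hηm N
  have hp : ∀ z : ℂ, ((N : ℂ) + 1) ^ z ≠ 0 := by
    intro z; rw [Ne, Complex.cpow_eq_zero_iff]; tauto
  have b1 := hp (ηp k - 1)
  have b2 := hp (ηm k - 1)
  have f1 : (N.factorial : ℂ) ≠ 0 := Nat.cast_ne_zero.2 (Nat.factorial_ne_zero _)
  have f2 : (k.factorial : ℂ) ≠ 0 := Nat.cast_ne_zero.2 (Nat.factorial_ne_zero _)
  have f3 : ((N - k).factorial : ℂ) ≠ 0 := Nat.cast_ne_zero.2 (Nat.factorial_ne_zero _)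
  have g1 := hp0 k
  have g2 := hm0 k
  have g3 : ηp k + N ≠ 0 := by rw [add_comm]; exact hp0 N
  have g4 : ηm k + N ≠ 0 := by rw [add_comm]; exact hm0 N
  have g5 : ((N : ℂ) + 1) ^ k ≠ 0 := pow_ne_zero _ hn1
  have sg : ((-1 : ℂ) ^ k) * (-1) ^ k = 1 := by rw [← mul_pow]; simp
  have sg0 : ((-1 : ℂ) ^ k) ≠ 0 := by simp
  have sg' : ((-1 : ℂ) ^ k)⁻¹ = (-1) ^ k := inv_eq_of_mul_eq_one_left sg
  generalize Hs (A + s + k) N = H1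
  generalize Hs (A + ηp k - k) N = H2
  generalize Hs (A + ηm k - k) N = H3
  generalize Hs (ηp k) N = H4 at *
  generalize Hs (ηm k) N = H5 at *
  generalize ((N : ℂ) + 1) ^ (3 - 3 * A - s) = c0 at *
  generalize ((N : ℂ) + 1) ^ (A + s + k - 1) = c1 at *
  generalize ((N : ℂ) + 1) ^ (A + ηp k - k - 1) = c2 at *
  generalize ((N : ℂ) + 1) ^ (A + ηm k - k - 1) = c3 at *
  generalize ((N : ℂ) + 1) ^ (ηp k - 1) = c4 at *
  generalize ((N : ℂ) + 1) ^ (ηm k - 1) = c5 at *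
  generalize ((N : ℂ) + 1) ^ k = c6 at *
  generalize (N.factorial : ℂ) = F1 at *
  generalize (k.factorial : ℂ) = F2 at *
  generalize ((N - k).factorial : ℂ) = F3 at *
  rw [show c0 * (H1 * (F1 * c1) * (H2 * (F1 * c2)) * (H3 * (F1 * c3))) =
    (c4 * c5 * ((N : ℂ) + 1) ^ 2 / c6) * (H1 * H2 * H3 * F1 ^ 3) by
      rw [← cp]; field_simp]
  generalize (-1 : ℂ) ^ k = ss at *
  generalize (x₁ + k) * (x₂ + k) * (x₃ + k) = Qk
  have : ss = ss⁻¹ := sg'.symm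
  rw [show ss / F2 = ss⁻¹ / F2 by rw [sg']]
  by_cases hQ : Qk = 0
  · simp [hQ]
  field_simp

theorem Tm_tendsto (a : ℤ) (s x₁ x₂ x₃ : ℂ) (ηp ηm : ℕ → ℂ) (k : ℕ)
    (hsum : ηp k + ηm k = s + k)
    (hηp : ∀ m : ℕ, ηp k ≠ -(m : ℂ))
    (hηm : ∀ m : ℕ, ηm k ≠ -(m : ℂ))
    (has : ∀ m : ℕ, (a : ℂ) + s ≠ -(m : ℂ)) :
    Tendsto (fun N => Tm a s x₁ x₂ x₃ ηp ηm N k) atTop (𝓝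
      ((Complex.Gamma (a + s))⁻¹ * (((-1 : ℂ) ^ k / (k.factorial : ℂ))
        * (gpoch (1 - ηp k) ((k : ℤ) - a) * gpoch (1 - ηm k) ((k : ℤ) - a)
            / poch ((a : ℂ) + s) k)
        * ((k + ηp k) * (k + ηm k) / ((x₁ + k) * (x₂ + k) * (x₃ + k)))))) := by
  have H : ∀ z, Tendsto (Hs z) atTop (𝓝 (Complex.Gamma z)⁻¹) := hseq_tendsto
  have G1 := Complex.Gamma_ne_zero hηp
  have G2 := Complex.Gamma_ne_zero hηm
  have L := (((((descFact_tendsto k).const_mul ((-1 : ℂ) ^ k / (k.factorial : ℂ))).mul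
    (((((H ((a : ℂ) + s + k)).mul (H ((a : ℂ) + ηp k - k))).mul (H ((a : ℂ) + ηm k - k))).mul
    ((H (ηp k)).inv₀ (inv_ne_zero G1))).mul ((H (ηm k)).inv₀ (inv_ne_zero G2)))).mul
    (ratio_tendsto (ηp k))).mul (ratio_tendsto (ηm k))).mul_const
    ((k + ηp k) * (k + ηm k) / ((x₁ + k) * (x₂ + k) * (x₃ + k)))
  have e : ∀ η : ℂ, (a : ℂ) + η - k = η - (((k : ℤ) - a : ℤ) : ℂ) := by
    intro η; push_cast; ring
  have q1 := Gamma_gpoch (ηp k) hηp ((k : ℤ) - a)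
  have q2 := Gamma_gpoch (ηm k) hηm ((k : ℤ) - a)
  have q3 := Gamma_inv_poch ((a : ℂ) + s) k
  have hne : poch ((a : ℂ) + s) k ≠ 0 :=
    Finset.prod_ne_zero_iff.2 fun j _ hh => has j (eq_neg_of_add_eq_zero_left hh)
  have sg : ((-1 : ℂ) ^ ((k : ℤ) - a)) * (-1) ^ ((k : ℤ) - a) = 1 := by
    rw [← mul_zpow]; simp
  rw [← e] at q1 q2
  rw [← poch] at q3
  refine (L.congr' ?_).trans (le_of_eq ?_)
  · filter_upwards [eventually_ge_atTop k] with N hN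
    rw [Tm_eq a s x₁ x₂ x₃ ηp ηm N k hN hsum hηp hηm]
  · congr 1
    rw [q3, inv_inv, inv_inv]
    have : (Complex.Gamma (a + s + k))⁻¹ * (Complex.Gamma (a + ηp k - k))⁻¹ *
      (Complex.Gamma (a + ηm k - k))⁻¹ * Complex.Gamma (ηp k) * Complex.Gamma (ηm k) =
      (Complex.Gamma (a + s + k))⁻¹ *
        (gpoch (1 - ηp k) ((k : ℤ) - a) * gpoch (1 - ηm k) ((k : ℤ) - a)) := by
      calc _ = (Complex.Gamma (a + s + k))⁻¹ * ((Complex.Gamma (ηp k) *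
              (Complex.Gamma (a + ηp k - k))⁻¹) * (Complex.Gamma (ηm k) *
              (Complex.Gamma (a + ηm k - k))⁻¹)) := by ring
        _ = _ := by rw [q1, q2]; linear_combination ((Complex.Gamma (a + s + k))⁻¹ *
            (gpoch (1 - ηp k) ((k : ℤ) - a) * gpoch (1 - ηm k) ((k : ℤ) - a))) * sg
    rw [this]
    generalize gpoch (1 - ηp k) ((k : ℤ) - a) = u
    generalize gpoch (1 - ηm k) ((k : ℤ) - a) = v
    generalize (Complex.Gamma (a + s + k))⁻¹ = y
    generalize (k + ηp k) * (k + ηm k) / ((x₁ + k) * (x₂ + k) * (x₃ + k)) = b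
    generalize (-1 : ℂ) ^ k / (k.factorial : ℂ) = c
    clear this q1 q2 q3 L sg
    generalize poch (a + s) k = p at *
    field_simp

theorem R_tendsto (A s x₁ x₂ x₃ : ℂ) (hs : s = x₁ + x₂ + x₃)
    (hx₁ : ∀ m : ℕ, x₁ ≠ -(m : ℂ))
    (hx₂ : ∀ m : ℕ, x₂ ≠ -(m : ℂ))
    (hx₃ : ∀ m : ℕ, x₃ ≠ -(m : ℂ)) :
    Tendsto (fun N : ℕ => ((N : ℂ) + 1) ^ (3 - 3 * A - s) *
      (∏ j ∈ Finset.range N, ((A + s - x₁ + j) * (A + s - x₂ + j) * (A + s - x₃ + j))) /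
      ∏ j ∈ Finset.range (N + 1), ((x₁ + j) * (x₂ + j) * (x₃ + j))) atTop
      (𝓝 (Complex.Gamma x₁ * Complex.Gamma x₂ * Complex.Gamma x₃
          / (Complex.Gamma (A + s - x₁)
            * Complex.Gamma (A + s - x₂)
            * Complex.Gamma (A + s - x₃)))) := by
  have H : ∀ z, Tendsto (Hs z) atTop (𝓝 (Complex.Gamma z)⁻¹) := hseq_tendsto
  have G1 := Complex.Gamma_ne_zero hx₁
  have G2 := Complex.Gamma_ne_zero hx₂
  have G3 := Complex.Gamma_ne_zero hx₃
  have L := ((((((((H (A + s - x₁)).mul (H (A + s - x₂))).mul (H (A + s - x₃))).mul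
    ((H x₁).inv₀ (inv_ne_zero G1))).mul ((H x₂).inv₀ (inv_ne_zero G2))).mul
    ((H x₃).inv₀ (inv_ne_zero G3))).mul (ratio_tendsto x₁)).mul (ratio_tendsto x₂)).mul
    (ratio_tendsto x₃)
  refine (L.congr ?_).trans (le_of_eq ?_)
  · intro N
    have hn1 : (N : ℂ) + 1 ≠ 0 := Nat.cast_add_one_ne_zero N
    have cp : ((N : ℂ) + 1) ^ (3 - 3 * A - s) * ((N : ℂ) + 1) ^ (A + s - x₁ - 1) *
      ((N : ℂ) + 1) ^ (A + s - x₂ - 1) * ((N : ℂ) + 1) ^ (A + s - x₃ - 1) =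
      ((N : ℂ) + 1) ^ (x₁ - 1) * ((N : ℂ) + 1) ^ (x₂ - 1) * ((N : ℂ) + 1) ^ (x₃ - 1)
        * ((N : ℂ) + 1) ^ 3 := by
      rw [← Complex.cpow_natCast _ 3]
      simp only [← Complex.cpow_add _ _ hn1]
      congr 1
      push_cast
      linear_combination 2 * hs
    simp only [Finset.prod_range_succ, Finset.prod_mul_distrib]
    simp only [prod_eq_Hs _ N]
    have a1 := Hs_ne_zero _ hx₁ N
    have a2 := Hs_ne_zero _ hx₂ N
    have a3 := Hs_ne_zero _ hx₃ N
    have hp : ∀ z : ℂ, ((N : ℂ) + 1) ^ z ≠ 0 := by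
      intro z; rw [Ne, Complex.cpow_eq_zero_iff]; tauto
    have b1 := hp (x₁ - 1)
    have b2 := hp (x₂ - 1)
    have b3 := hp (x₃ - 1)
    have f1 : (N.factorial : ℂ) ≠ 0 := Nat.cast_ne_zero.2 (Nat.factorial_ne_zero _)
    have g1 : x₁ + N ≠ 0 := fun h => hx₁ N (by linear_combination h)
    have g2 : x₂ + N ≠ 0 := fun h => hx₂ N (by linear_combination h)
    have g3 : x₃ + N ≠ 0 := fun h => hx₃ N (by linear_combination h)
    generalize Hs (A + s - x₁) N = H1
    generalize Hs (A + s - x₂) N = H2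
    generalize Hs (A + s - x₃) N = H3
    generalize Hs x₁ N = H4 at *
    generalize Hs x₂ N = H5 at *
    generalize Hs x₃ N = H6 at *
    generalize ((N : ℂ) + 1) ^ (3 - 3 * A - s) = c0 at *
    generalize ((N : ℂ) + 1) ^ (A + s - x₁ - 1) = c1 at *
    generalize ((N : ℂ) + 1) ^ (A + s - x₂ - 1) = c2 at *
    generalize ((N : ℂ) + 1) ^ (A + s - x₃ - 1) = c3 at *
    generalize ((N : ℂ) + 1) ^ (x₁ - 1) = c4 at *
    generalize ((N : ℂ) + 1) ^ (x₂ - 1) = c5 at *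
    generalize ((N : ℂ) + 1) ^ (x₃ - 1) = c6 at *
    generalize (N.factorial : ℂ) = F1 at *
    rw [show c0 * (H1 * (F1 * c1) * (H2 * (F1 * c2)) * (H3 * (F1 * c3))) =
      (c4 * c5 * c6 * ((N : ℂ) + 1) ^ 3) * (H1 * H2 * H3 * F1 ^ 3) by
        rw [← cp]; ring]
    field_simp
  · congr 1
    simp only [inv_inv, mul_one, div_eq_mul_inv, mul_inv]
    ring

theorem V_bound (B : ℝ) (hB : 0 ≤ B) : ∃ K > 0, ∀ n : ℕ,
    ∏ j ∈ Finset.range n, (1 + B / ((j : ℝ) + 1) ^ 2) ≤ K := by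
  have hsum : Summable (fun j : ℕ => B / ((j : ℝ) + 1) ^ 2) := by
    have h := (summable_nat_add_iff 1).2 (Real.summable_one_div_nat_pow.2 (one_lt_two))
    refine (h.mul_left B).congr fun j => ?_
    push_cast; ring
  refine ⟨Real.exp (∑' j : ℕ, B / ((j : ℝ) + 1) ^ 2), Real.exp_pos _, fun n => ?_⟩
  refine (Real.prod_one_add_le_exp_sum _ fun j => by positivity).trans ?_
  exact Real.exp_le_exp.2 (hsum.sum_le_tsum _ fun j _ => by positivity)

theorem num_factor (X Y ε : ℂ) (x y c c' p q E : ℝ) (hX : ‖X‖ ≤ x) (hY : ‖Y‖ ≤ y)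
    (hc : 0 < c) (hc' : 0 < c') (hp : 0 < p) (hq : 0 < q) (hxp : c * p ≤ x) (hyq : c' * q ≤ y)
    (hE : ‖ε‖ ≤ E) :
    ‖X * Y + ε‖ ≤ (x * (1 + E / (c * c') / p ^ 2)) * (y * (1 + E / (c * c') / q ^ 2)) := by
  have hE0 : 0 ≤ E := (norm_nonneg _).trans hE
  have hx : 0 < x := (mul_pos hc hp).trans_le hxp
  have hy : 0 < y := (mul_pos hc' hq).trans_le hyq
  have h1 : ‖X * Y + ε‖ ≤ x * y + E := by
    refine (norm_add_le _ _).trans (add_le_add ?_ hE)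
    rw [norm_mul]; gcongr
  set B := E / (c * c') with hB
  have hB0 : 0 ≤ B := by positivity
  have hEB : E = B * (c * c') := by rw [hB]; field_simp
  have h2 : E ≤ x * y * (B / p ^ 2 + B / q ^ 2) := by
    have h3 : (c * p) * (c' * q) ≤ x * y := by gcongr
    have h4 : E = (c * p) * (c' * q) * (B / (p * q)) := by rw [hEB]; field_simp
    have h5 : B / (p * q) ≤ B / p ^ 2 + B / q ^ 2 := by
      have : B / p ^ 2 + B / q ^ 2 - B / (p * q) = B * ((1/p - 1/q) ^ 2 + 1/(p*q)) := by
        field_simp; ring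
      have : 0 ≤ B * ((1/p - 1/q) ^ 2 + 1/(p*q)) := by positivity
      linarith
    rw [h4]; gcongr
  have h6 : 0 ≤ x * y * (B / p ^ 2 * (B / q ^ 2)) := by positivity
  calc _ ≤ _ := h1
    _ ≤ x * y + x * y * (B / p ^ 2 + B / q ^ 2) + x * y * (B / p ^ 2 * (B / q ^ 2)) := by linarith
    _ = _ := by ring

theorem eps_id (lam s k p m t : ℂ) (h1 : p + m = s + k) :
    (t + p) * (t + m) = (lam + t) * (s - lam + (k + t)) + (p - lam) * (m - lam) := by
  have hm : m = s + k - p := by linear_combination h1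
  subst hm; ring

theorem num_bound (A lam s : ℂ) (p m : ℕ → ℂ) (E : ℝ)
    (hsum : ∀ k : ℕ, p k + m k = s + k) (hE : ∀ k, ‖(p k - lam) * (m k - lam)‖ ≤ E) :
    ∃ C > 0, ∀ k M : ℕ, ∏ j ∈ Finset.range (k + M), ‖(A + p k - k + j) * (A + m k - k + j)‖ ≤
      C * (((k.factorial : ℝ) * ((k : ℝ) + 1) ^ (-(A + lam).re)) *
        ((M.factorial : ℝ) * ((M : ℝ) + 1) ^ ((A + lam).re - 1)) *
        (((k + M).factorial : ℝ) * (((k + M : ℕ) : ℝ) + 1) ^ ((A + s - lam).re - 1))) := by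
  have hE0 : 0 ≤ E := (norm_nonneg _).trans (hE 0)
  obtain ⟨Z2, r2, n2, l2, -⟩ := exists_reg (1 - (A + lam))
  obtain ⟨Z3, r3, n3, l3, -⟩ := exists_reg (A + lam)
  obtain ⟨Z4, r4, n4, l4, -⟩ := exists_reg (A + s - lam)
  obtain ⟨c2, hc2, b2⟩ := lin_lower Z2 n2
  obtain ⟨c3, hc3, b3⟩ := lin_lower Z3 n3
  obtain ⟨c4, hc4, b4⟩ := lin_lower Z4 n4
  obtain ⟨_d2, _hd2, C2, hC2, u2⟩ := prod_bounds Z2 n2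
  obtain ⟨_d3, _hd3, C3, hC3, u3⟩ := prod_bounds Z3 n3
  obtain ⟨_d4, _hd4, C4, hC4, u4⟩ := prod_bounds Z4 n4
  obtain ⟨K2, hK2, v2⟩ := V_bound (E / (c2 * c4)) (by positivity)
  obtain ⟨K3, hK3, v3⟩ := V_bound (E / (c3 * c4)) (by positivity)
  set B4 := E / (c2 * c4) + E / (c3 * c4) with hB4
  obtain ⟨K4, hK4, v4⟩ := V_bound B4 (by positivity)
  set g : ℕ → ℝ := fun j => ‖Z4 + j‖ * (1 + B4 / ((j : ℝ) + 1) ^ 2) with hg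
  set f2 : ℕ → ℝ := fun j => ‖Z2 + j‖ * (1 + E / (c2 * c4) / ((j : ℝ) + 1) ^ 2) with hf2
  set f3 : ℕ → ℝ := fun j => ‖Z3 + j‖ * (1 + E / (c3 * c4) / ((j : ℝ) + 1) ^ 2) with hf3
  have g0 : ∀ j, 0 ≤ g j := fun j => by positivity
  have f20 : ∀ j, 0 ≤ f2 j := fun j => by positivity
  have f30 : ∀ j, 0 ≤ f3 j := fun j => by positivity
  refine ⟨(C2 * K2) * (C3 * K3) * (C4 * K4), by positivity, fun k M => ?_⟩
  have fac : ∀ j : ℕ, (A + p k - k + j) * (A + m k - k + j) =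
      ((A + lam) + ((j : ℂ) - k)) * ((A + s - lam) + j) + (p k - lam) * (m k - lam) := by
    intro j
    have := eps_id lam s k (p k) (m k) (A - k + j) (hsum k)
    linear_combination this
  have s1 : ∀ i ∈ Finset.range k, ‖(A + p k - k + i) * (A + m k - k + i)‖ ≤ f2 (k - 1 - i) * g i := by
    intro i hi
    have hik : i + 1 ≤ k := Finset.mem_range.1 hi
    rw [fac i]
    have e : ‖(A + lam) + ((i : ℂ) - k)‖ ≤ ‖Z2 + ((k - 1 - i : ℕ) : ℂ)‖ := by
      have := l2 ((k - 1 - i : ℕ) : ℝ)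
      rw [Complex.ofReal_natCast] at this
      refine le_trans (le_of_eq ?_) this
      rw [← norm_neg]
      congr 1
      rw [show k - 1 - i = k - (i + 1) by omega, Nat.cast_sub hik]
      push_cast; ring
    have e4 := l4 (i : ℝ)
    rw [Complex.ofReal_natCast] at e4
    refine (num_factor _ _ _ _ _ c2 c4 _ _ E e e4 hc2 hc4 (by positivity) (by positivity)
      (b2 _) (b4 _) (hE k)).trans ?_
    have : E / (c2 * c4) ≤ B4 := by rw [hB4]; have : 0 ≤ E / (c3 * c4) := by positivity
                                    linarith
    simp only [hf2, hg]
    gcongr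
  have s2 : ∀ i ∈ Finset.range M, ‖(A + p k - k + ((k + i : ℕ) : ℂ)) * (A + m k - k + ((k + i : ℕ) : ℂ))‖
      ≤ f3 i * g (k + i) := by
    intro i hi
    rw [fac]
    have e : ‖(A + lam) + (((k + i : ℕ) : ℂ) - k)‖ ≤ ‖Z3 + (i : ℂ)‖ := by
      have := l3 (i : ℝ)
      rw [Complex.ofReal_natCast] at this
      refine le_trans (le_of_eq ?_) this
      congr 1
      push_cast; ring
    have e4 := l4 ((k + i : ℕ) : ℝ)
    rw [Complex.ofReal_natCast] at e4
    refine (num_factor _ _ _ _ _ c3 c4 _ _ E e e4 hc3 hc4 (by positivity) (by positivity)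
      (b3 _) (b4 _) (hE k)).trans ?_
    have : E / (c3 * c4) ≤ B4 := by rw [hB4]; have : 0 ≤ E / (c2 * c4) := by positivity
                                    linarith
    simp only [hf3, hg]
    gcongr
  have t2 : ∏ j ∈ Finset.range k, f2 j ≤
      (C2 * ((k.factorial : ℝ) * ((k : ℝ) + 1) ^ (-(A + lam).re))) * K2 := by
    rw [hf2, Finset.prod_mul_distrib]
    have := (u2 k).2
    rw [r2, show (1 - (A + lam)).re - 1 = -(A + lam).re by simp] at this
    have := v2 k
    gcongr
  have t3 : ∏ j ∈ Finset.range M, f3 j ≤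
      (C3 * ((M.factorial : ℝ) * ((M : ℝ) + 1) ^ ((A + lam).re - 1))) * K3 := by
    rw [hf3, Finset.prod_mul_distrib]
    have := (u3 M).2
    rw [r3] at this
    have := v3 M
    gcongr
  have t4 : ∏ j ∈ Finset.range (k + M), g j ≤
      (C4 * (((k + M).factorial : ℝ) * (((k + M : ℕ) : ℝ) + 1) ^ ((A + s - lam).re - 1))) * K4 := by
    rw [hg, Finset.prod_mul_distrib]
    have := (u4 (k + M)).2
    rw [r4] at this
    have := v4 (k + M)
    gcongr
  clear_value f2 f3 g
  calc ∏ j ∈ Finset.range (k + M), ‖(A + p k - k + j) * (A + m k - k + j)‖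
      ≤ (∏ i ∈ Finset.range k, (f2 (k - 1 - i) * g i)) *
        ∏ i ∈ Finset.range M, (f3 i * g (k + i)) := by
        rw [Finset.prod_range_add]
        refine mul_le_mul (Finset.prod_le_prod (fun _ _ => norm_nonneg _) s1)
          (Finset.prod_le_prod (fun _ _ => norm_nonneg _) s2)
          (Finset.prod_nonneg fun _ _ => norm_nonneg _)
          (Finset.prod_nonneg fun _ _ => mul_nonneg (f20 _) (g0 _))
    _ = (∏ j ∈ Finset.range k, f2 j) * (∏ j ∈ Finset.range M, f3 j) *
        (∏ j ∈ Finset.range (k + M), g j) := by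
        rw [Finset.prod_mul_distrib, Finset.prod_mul_distrib, Finset.prod_range_reflect,
          Finset.prod_range_add g]
        ring
    _ ≤ ((C2 * ((k.factorial : ℝ) * ((k : ℝ) + 1) ^ (-(A + lam).re))) * K2) *
        ((C3 * ((M.factorial : ℝ) * ((M : ℝ) + 1) ^ ((A + lam).re - 1))) * K3) *
        ((C4 * (((k + M).factorial : ℝ) * (((k + M : ℕ) : ℝ) + 1) ^ ((A + s - lam).re - 1))) * K4) := by
        have p2 : 0 ≤ ∏ j ∈ Finset.range k, f2 j := Finset.prod_nonneg fun j _ => f20 j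
        have p3 : 0 ≤ ∏ j ∈ Finset.range M, f3 j := Finset.prod_nonneg fun j _ => f30 j
        have p4 : 0 ≤ ∏ j ∈ Finset.range (k + M), g j := Finset.prod_nonneg fun j _ => g0 j
        gcongr
    _ = _ := by ring

theorem den_bound (lam s : ℂ) (p m : ℕ → ℂ) (E : ℝ) (hlam : ∀ m : ℕ, lam ≠ -(m : ℂ))
    (hsum : ∀ k : ℕ, p k + m k = s + k) (hE : ∀ k, ‖(p k - lam) * (m k - lam)‖ ≤ E) :
    ∃ C > 0, ∃ k0 : ℕ, ∀ k N : ℕ, k0 ≤ k →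
      ((N.factorial : ℝ) * ((N : ℝ) + 1) ^ lam.re) *
      (((k + N).factorial : ℝ) * (((k + N : ℕ) : ℝ) + 1) ^ (s - lam).re) ≤
      C * ((k.factorial : ℝ) * ((k : ℝ) + 1) ^ ((s - lam).re - 1)) *
        ∏ j ∈ Finset.range (N + 1), ‖((j : ℂ) + p k) * (j + m k)‖ := by
  have hE0 : 0 ≤ E := (norm_nonneg _).trans (hE 0)
  obtain ⟨Z, r5, n5, l5, D, hD, q5⟩ := exists_reg (s - lam)
  obtain ⟨c, hc, b⟩ := lin_lower lam hlam
  obtain ⟨c5, hc5, b5⟩ := lin_lower Z n5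
  obtain ⟨d, hd, _D, _hD, u⟩ := prod_bounds lam hlam
  obtain ⟨d5, hd5, C5, hC5, u5⟩ := prod_bounds Z n5
  obtain ⟨K1, hK1, v1⟩ := V_bound (4 * E / c) (by positivity)
  obtain ⟨K2, hK2, v2⟩ := V_bound (4 * D) (by positivity)
  obtain ⟨k0, hk0⟩ := exists_nat_ge (2 * ‖s - lam‖ + 1 + 4 * E / c)
  refine ⟨(d * c * (d5 * c5))⁻¹ * (C5 * (K1 * K2)), by positivity, k0, fun k N hk => ?_⟩
  have hkr : 2 * ‖s - lam‖ + 1 + 4 * E / c ≤ k := hk0.trans (by exact_mod_cast hk)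
  have hEc : 0 ≤ 4 * E / c := by positivity
  have hk1 : (1 : ℝ) ≤ k := by have := norm_nonneg (s - lam); linarith
  have s1 : ∀ j ∈ Finset.range (N + 1), ‖lam + j‖ * ‖Z + ((k + j : ℕ) : ℂ)‖ ≤
      ((1 + 4 * E / c / ((j : ℝ) + 1) ^ 2) * (1 + 4 * D / ((j : ℝ) + 1) ^ 2)) *
        ‖((j : ℂ) + p k) * (j + m k)‖ := by
    intro j _
    rw [eps_id lam s k (p k) (m k) j (hsum k)]
    set X := lam + (j : ℂ)
    set Y := s - lam + ((k : ℂ) + j) with hY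
    set ε := (p k - lam) * (m k - lam)
    set P : ℝ := (j : ℝ) + 1 with hP
    have hP1 : 1 ≤ P := by rw [hP]; have : (0 : ℝ) ≤ j := by positivity
                           linarith
    have hX : c * P ≤ ‖X‖ := b j
    have hYn : ((k : ℝ) + j) / 2 ≤ ‖Y‖ := by
      have h1 : ((k : ℝ) + j) ≤ ‖Y‖ + ‖s - lam‖ := by
        have : ((k + j : ℕ) : ℂ) = Y - (s - lam) := by rw [hY]; push_cast; ring
        have h2 := norm_sub_le Y (s - lam)
        rw [← this, Complex.norm_natCast] at h2
        push_cast at h2; exact h2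
      have : (0 : ℝ) ≤ j := by positivity
      linarith
    have hYP : P / 2 ≤ ‖Y‖ := by rw [hP]; linarith
    have hYk : (k : ℝ) / 2 ≤ ‖Y‖ := by have : (0 : ℝ) ≤ j := by positivity
                                       linarith
    have hY0 : 0 < ‖Y‖ := by linarith
    have hX0 : 0 < ‖X‖ := lt_of_lt_of_le (by positivity) hX
    have hε := hE k
    have hXc : c ≤ ‖X‖ := le_trans (by nlinarith) hX
    have h2E : E ≤ ‖X‖ * ‖Y‖ / 2 := by
      have : c * (k / 2) ≤ ‖X‖ * ‖Y‖ := by gcongr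
      have h4 : 4 * E / c ≤ k := by have := norm_nonneg (s - lam); linarith
      rw [div_le_iff₀ hc] at h4
      linarith
    set W := ‖X * Y + ε‖ with hW
    have hXY : ‖X‖ * ‖Y‖ ≤ W + E := by
      have := norm_sub_le (X * Y + ε) ε
      rw [add_sub_cancel_right, norm_mul] at this
      linarith
    have hWl : c * P ^ 2 / 4 ≤ W := by
      have : (c * P) * (P / 2) ≤ ‖X‖ * ‖Y‖ := by gcongr
      nlinarith
    have hW1 : ‖X‖ * ‖Y‖ ≤ (1 + 4 * E / c / P ^ 2) * W := by
      have : E = 4 * E / c / P ^ 2 * (c * P ^ 2 / 4) := by field_simp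
      have h7 : 4 * E / c / P ^ 2 * (c * P ^ 2 / 4) ≤ 4 * E / c / P ^ 2 * W := by gcongr
      linarith
    have hY5 : ‖Z + ((k + j : ℕ) : ℂ)‖ ≤ (1 + 4 * D / P ^ 2) * ‖Y‖ := by
      have h1 := q5 ((k + j : ℕ) : ℝ)
      rw [Complex.ofReal_natCast] at h1
      have h2 : s - lam + ((k + j : ℕ) : ℂ) = Y := by rw [hY]; push_cast; ring
      rw [h2] at h1
      rw [← sq_le_sq₀ (norm_nonneg _) (by positivity)]
      refine h1.trans ?_
      have h3 : D ≤ 4 * D / P ^ 2 * ‖Y‖ ^ 2 := by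
        have : D = 4 * D / P ^ 2 * (P / 2) ^ 2 := by field_simp; norm_num
        calc D = _ := this
          _ ≤ _ := by gcongr
      have h4 : 0 ≤ 4 * D / P ^ 2 := by positivity
      have h5 : 0 ≤ ‖Y‖ ^ 2 := by positivity
      have h6 : 0 ≤ (4 * D / P ^ 2) ^ 2 * ‖Y‖ ^ 2 := by positivity
      nlinarith
    calc ‖X‖ * ‖Z + ((k + j : ℕ) : ℂ)‖ ≤ ‖X‖ * ((1 + 4 * D / P ^ 2) * ‖Y‖) := by gcongr
      _ = (1 + 4 * D / P ^ 2) * (‖X‖ * ‖Y‖) := by ring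
      _ ≤ (1 + 4 * D / P ^ 2) * ((1 + 4 * E / c / P ^ 2) * W) := by gcongr
      _ = _ := by ring
  have s2 := Finset.prod_le_prod (fun j _ => by positivity) s1
  rw [Finset.prod_mul_distrib, Finset.prod_mul_distrib, Finset.prod_mul_distrib] at s2
  set W := ∏ j ∈ Finset.range (N + 1), ‖((j : ℂ) + p k) * (j + m k)‖
  have hW0 : 0 ≤ W := Finset.prod_nonneg fun _ _ => norm_nonneg _
  have s3 : (∏ j ∈ Finset.range (N + 1), ‖lam + j‖) *
      ∏ j ∈ Finset.range (N + 1), ‖Z + ((k + j : ℕ) : ℂ)‖ ≤ (K1 * K2) * W := by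
    refine s2.trans ?_
    have := v1 (N + 1)
    have := v2 (N + 1)
    gcongr
  have w1 : d * c * ((N.factorial : ℝ) * ((N : ℝ) + 1) ^ lam.re) ≤
      ∏ j ∈ Finset.range (N + 1), ‖lam + j‖ := by
    rw [Finset.prod_range_succ]
    have h1 := (u N).1
    have h2 := b N
    have : ((N : ℝ) + 1) ^ lam.re = ((N : ℝ) + 1) ^ (lam.re - 1) * (N + 1) := by
      rw [Real.rpow_sub_one (by positivity)]; field_simp
    rw [this]
    calc _ = (d * ((N.factorial : ℝ) * ((N : ℝ) + 1) ^ (lam.re - 1))) * (c * (N + 1)) := by ring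
      _ ≤ _ := by gcongr
  have w2 : d5 * c5 * (((k + N).factorial : ℝ) * (((k + N : ℕ) : ℝ) + 1) ^ (s - lam).re) ≤
      ∏ j ∈ Finset.range (k + N + 1), ‖Z + j‖ := by
    rw [Finset.prod_range_succ]
    have h1 := (u5 (k + N)).1
    have h2 := b5 (k + N)
    have : (((k + N : ℕ) : ℝ) + 1) ^ (s - lam).re =
        (((k + N : ℕ) : ℝ) + 1) ^ ((s - lam).re - 1) * (((k + N : ℕ) : ℝ) + 1) := by
      rw [Real.rpow_sub_one (by positivity)]; field_simp
    rw [this]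
    rw [r5] at h1
    calc _ = (d5 * (((k + N).factorial : ℝ) * (((k + N : ℕ) : ℝ) + 1) ^ ((s - lam).re - 1)))
          * (c5 * (((k + N : ℕ) : ℝ) + 1)) := by ring
      _ ≤ _ := by gcongr
  rw [show k + N + 1 = k + (N + 1) by ring, Finset.prod_range_add] at w2
  have w3 := (u5 k).2
  rw [r5] at w3
  set F1 := (N.factorial : ℝ) * ((N : ℝ) + 1) ^ lam.re
  set F2 := ((k + N).factorial : ℝ) * (((k + N : ℕ) : ℝ) + 1) ^ (s - lam).re
  set F3 := (k.factorial : ℝ) * ((k : ℝ) + 1) ^ ((s - lam).re - 1)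
  have hF1 : 0 ≤ F1 := by positivity
  have hF2 : 0 ≤ F2 := by positivity
  have hF3 : 0 ≤ F3 := by positivity
  have main : (d * c * F1) * (d5 * c5 * F2) ≤ (C5 * F3) * ((K1 * K2) * W) := by
    calc (d * c * F1) * (d5 * c5 * F2) ≤ (∏ j ∈ Finset.range (N + 1), ‖lam + j‖) *
          ((∏ j ∈ Finset.range k, ‖Z + j‖) *
            ∏ j ∈ Finset.range (N + 1), ‖Z + ((k + j : ℕ) : ℂ)‖) := by gcongr
      _ = (∏ j ∈ Finset.range k, ‖Z + j‖) * ((∏ j ∈ Finset.range (N + 1), ‖lam + j‖) *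
            ∏ j ∈ Finset.range (N + 1), ‖Z + ((k + j : ℕ) : ℂ)‖) := by ring
      _ ≤ _ := by gcongr
  have hpos : 0 < d * c * (d5 * c5) := by positivity
  calc F1 * F2 = (d * c * (d5 * c5))⁻¹ * ((d * c * F1) * (d5 * c5 * F2)) := by field_simp
    _ ≤ (d * c * (d5 * c5))⁻¹ * ((C5 * F3) * ((K1 * K2) * W)) := by gcongr
    _ = _ := by ring

theorem rpow_le_two (q n t : ℝ) (hn : 0 < n) (h1 : n ≤ q) (h2 : q ≤ 2 * n) :
    q ^ t ≤ 2 ^ |t| * n ^ t := by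
  have hq : 0 < q := hn.trans_le h1
  have e : q ^ t = (q / n) ^ t * n ^ t := by
    rw [← Real.mul_rpow (by positivity) hn.le]; congr 1; field_simp
  rw [e]
  have hr1 : 1 ≤ q / n := (one_le_div hn).2 h1
  have hr2 : q / n ≤ 2 := (div_le_iff₀ hn).2 h2
  gcongr
  calc (q / n) ^ t ≤ (q / n) ^ |t| := Real.rpow_le_rpow_of_exponent_le hr1 (le_abs_self t)
    _ ≤ 2 ^ |t| := Real.rpow_le_rpow (by positivity) hr2 (abs_nonneg t)

theorem Tm_bound (A lam x₁ x₂ x₃ s : ℂ)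
    (ηp ηm : ℕ → ℂ)
    (hη : ∀ k : ℕ, ηp k + ηm k = s + k
      ∧ (-(k : ℂ) - lam) * (ηp k - lam) * (ηm k - lam)
          = (x₁ - lam) * (x₂ - lam) * (x₃ - lam))
    (hx₁ : ∀ m : ℕ, x₁ ≠ -(m : ℂ))
    (hx₂ : ∀ m : ℕ, x₂ ≠ -(m : ℂ))
    (hx₃ : ∀ m : ℕ, x₃ ≠ -(m : ℂ))
    (hlam : ∀ m : ℕ, lam ≠ -(m : ℂ))
    (has : ∀ m : ℕ, A + s ≠ -(m : ℂ))
    (hηp : ∀ k : ℕ, ∀ m : ℕ, ηp k ≠ -(m : ℂ))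
    (hηm : ∀ k : ℕ, ∀ m : ℕ, ηm k ≠ -(m : ℂ)) :
    ∃ C > 0, ∃ k0 : ℕ, ∀ k M : ℕ, k0 ≤ k → ‖Tm A s x₁ x₂ x₃ ηp ηm (k + M) k‖ ≤
      C * (((k : ℝ) + 1) ^ (-2 * (A + lam).re - 1) * ((M : ℝ) + 1) ^ ((A + lam).re - 1)
        * (((k + M : ℕ) : ℝ) + 1) ^ (1 - (A + lam).re)) := by
  obtain ⟨c, hc, b⟩ := lin_lower lam hlam
  obtain ⟨c1, hc1, b1⟩ := lin_lower x₁ hx₁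
  obtain ⟨c2, hc2, b2⟩ := lin_lower x₂ hx₂
  obtain ⟨c3, hc3, b3⟩ := lin_lower x₃ hx₃
  set E : ℝ := ‖(x₁ - lam) * (x₂ - lam) * (x₃ - lam)‖ / c with hEdef
  have hE0 : 0 ≤ E := by positivity
  have hE : ∀ k, ‖(ηp k - lam) * (ηm k - lam)‖ ≤ E := by
    intro k
    have h := congrArg norm (hη k).2
    rw [mul_assoc, norm_mul] at h
    have hb : c ≤ ‖-(k : ℂ) - lam‖ := by
      rw [show -(k : ℂ) - lam = -(lam + k) by ring, norm_neg]
      refine le_trans ?_ (b k)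
      have : (0 : ℝ) ≤ k := by positivity
      nlinarith
    rw [hEdef, le_div_iff₀ hc, ← h, mul_comm]
    gcongr
  obtain ⟨Cn, hCn, nb⟩ := num_bound A lam s ηp ηm E (fun k => (hη k).1) hE
  obtain ⟨Cd, hCd, k0, db⟩ := den_bound lam s ηp ηm E hlam (fun k => (hη k).1) hE
  obtain ⟨d, hd, D, hD, u⟩ := prod_bounds (A + s) has
  -- upper bound for the removed factor
  set G : ℝ := (‖lam‖ + 1) * (‖s - lam‖ + 2) + E with hG
  have hG0 : 0 < G := by positivity
  have gb : ∀ k : ℕ, ‖((k : ℂ) + ηp k) * (k + ηm k)‖ ≤ G * ((k : ℝ) + 1) ^ 2 := by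
    intro k
    rw [eps_id lam s k (ηp k) (ηm k) k (hη k).1]
    have hk0 : (0 : ℝ) ≤ k := by positivity
    have h1 : ‖lam + k‖ ≤ (‖lam‖ + 1) * ((k : ℝ) + 1) := by
      refine (norm_add_le _ _).trans ?_
      rw [Complex.norm_natCast]; nlinarith [norm_nonneg lam]
    have h2 : ‖s - lam + ((k : ℂ) + k)‖ ≤ (‖s - lam‖ + 2) * ((k : ℝ) + 1) := by
      refine (norm_add_le _ _).trans ?_
      rw [show (k : ℂ) + k = ((k + k : ℕ) : ℂ) by push_cast; ring, Complex.norm_natCast]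
      push_cast
      nlinarith [norm_nonneg (s - lam)]
    calc _ ≤ ‖(lam + k) * (s - lam + ((k : ℂ) + k))‖ + ‖(ηp k - lam) * (ηm k - lam)‖ :=
          norm_add_le _ _
      _ ≤ ((‖lam‖ + 1) * ((k : ℝ) + 1)) * ((‖s - lam‖ + 2) * ((k : ℝ) + 1)) + E := by
          rw [norm_mul]
          have := hE k
          gcongr
      _ ≤ _ := by
          have e1 : (1 : ℝ) ≤ ((k : ℝ) + 1) ^ 2 := by nlinarith
          have e2 := mul_le_mul_of_nonneg_left e1 hE0
          rw [hG]
          linarith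
  refine ⟨D * d⁻¹ * Cn * (Cd * G * (c1 * c2 * c3)⁻¹) * 2 ^ |(A + lam).re - 1|, by positivity, k0,
    fun k M hk => ?_⟩
  set N := k + M with hN
  have hkN : k ∈ Finset.range (N + 1) := Finset.mem_range.2 (by omega)
  have np := nb k M
  have dp := db k N hk
  rw [← hN] at np
  rw [← Finset.mul_prod_erase _ _ hkN] at dp
  have pos : ∀ j : ℕ, 0 < ‖((j : ℂ) + ηp k) * (j + ηm k)‖ := fun j =>
    norm_pos_iff.2 (mul_ne_zero (fun h => hηp k j (by linear_combination h))
      (fun h => hηm k j (by linear_combination h)))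
  set EP := ∏ j ∈ (Finset.range (N + 1)).erase k, ‖((j : ℂ) + ηp k) * (j + ηm k)‖ with hEP
  have hEP0 : 0 < EP := Finset.prod_pos fun j _ => pos j
  set NP := ∏ j ∈ Finset.range N, ‖(A + ηp k - k + j) * (A + ηm k - k + j)‖ with hNP
  have hNP0 : 0 ≤ NP := Finset.prod_nonneg fun j _ => norm_nonneg _
  set P1 := ∏ j ∈ Finset.range N, ‖A + s + k + j‖ with hP1
  have hP10 : 0 ≤ P1 := Finset.prod_nonneg fun j _ => norm_nonneg _
  set Qn := ‖(x₁ + k) * (x₂ + k) * (x₃ + k)‖ with hQn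
  have Tn : ‖Tm A s x₁ x₂ x₃ ηp ηm N k‖ = ((N : ℝ) + 1) ^ (3 - 3 * A - s).re * (P1 * NP) /
      ((k.factorial * M.factorial * EP) * Qn) := by
    have hnum : ‖∏ j ∈ Finset.range N, ((A + s + k + j) * (A + ηp k - k + j) *
        (A + ηm k - k + j))‖ = P1 * NP := by
      rw [norm_prod, hP1, hNP, ← Finset.prod_mul_distrib]
      refine Finset.prod_congr rfl fun j _ => ?_
      simp only [norm_mul]
      ring
    have hden : ‖∏ j ∈ (Finset.range (N + 1)).erase k, (((j : ℂ) - k) * (j + ηp k) *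
        (j + ηm k))‖ = k.factorial * M.factorial * EP := by
      have e : ∏ j ∈ (Finset.range (N + 1)).erase k, (((j : ℂ) - k) * (j + ηp k) *
          (j + ηm k)) = (∏ j ∈ (Finset.range (N + 1)).erase k, ((j : ℂ) - k)) *
          ∏ j ∈ (Finset.range (N + 1)).erase k, (((j : ℂ) + ηp k) * (j + ηm k)) := by
        rw [← Finset.prod_mul_distrib]
        refine Finset.prod_congr rfl fun j _ => ?_
        ring
      have e2 : ∏ j ∈ (Finset.range (N + 1)).erase k, ((j : ℂ) - k) = _ := prod_erase_sub k M
      rw [e, norm_mul, e2, hEP, norm_prod]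
      simp
    rw [Tm, norm_div, norm_mul, norm_mul, norm_cpow_nat1, hnum, hden]
  have hQ : (c1 * c2 * c3) * ((k : ℝ) + 1) ^ 3 ≤ Qn := by
    rw [hQn, norm_mul, norm_mul]
    have := b1 k
    have := b2 k
    have := b3 k
    calc _ = (c1 * ((k : ℝ) + 1)) * (c2 * ((k : ℝ) + 1)) * (c3 * ((k : ℝ) + 1)) := by ring
      _ ≤ _ := by gcongr
  have hP : d * ((k.factorial : ℝ) * ((k : ℝ) + 1) ^ ((A + s).re - 1)) * P1 ≤
      D * (((k + N).factorial : ℝ) * (((k + N : ℕ) : ℝ) + 1) ^ ((A + s).re - 1)) := by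
    refine le_trans ?_ (u (k + N)).2
    rw [Finset.prod_range_add]
    have h1 := (u k).1
    have h2 : ∏ j ∈ Finset.range N, ‖A + s + ((k + j : ℕ) : ℂ)‖ = P1 :=
      Finset.prod_congr rfl fun j _ => by congr 1; push_cast; ring
    rw [h2]
    gcongr
  have gk := gb k
  have dp2 : ((N.factorial : ℝ) * ((N : ℝ) + 1) ^ lam.re) *
      (((k + N).factorial : ℝ) * (((k + N : ℕ) : ℝ) + 1) ^ (s - lam).re) ≤
      Cd * ((k.factorial : ℝ) * ((k : ℝ) + 1) ^ ((s - lam).re - 1)) *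
        (G * ((k : ℝ) + 1) ^ 2 * EP) := by
    refine dp.trans ?_
    gcongr
  have hn : (0 : ℝ) < (N : ℝ) + 1 := by positivity
  have hκ : (0 : ℝ) < (k : ℝ) + 1 := by positivity
  have hm : (0 : ℝ) < (M : ℝ) + 1 := by positivity
  have hq : (0 : ℝ) < ((k + N : ℕ) : ℝ) + 1 := by positivity
  have q2 : (((k + N : ℕ) : ℝ) + 1) ^ ((A + lam).re - 1) ≤
      2 ^ |(A + lam).re - 1| * ((N : ℝ) + 1) ^ ((A + lam).re - 1) := by
    have hkN' : (k : ℝ) ≤ N := by exact_mod_cast (by omega : k ≤ N)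
    have : (0 : ℝ) ≤ k := by positivity
    apply rpow_le_two _ _ _ hn <;> push_cast <;> linarith
  have hNe : ((N : ℝ) + 1) ^ (3 - 3 * A - s).re * ((N : ℝ) + 1) ^ ((A + s - lam).re - 1) *
      ((N : ℝ) + 1) ^ ((A + lam).re - 1) =
      ((N : ℝ) + 1) ^ lam.re * ((N : ℝ) + 1) ^ (1 - (A + lam).re) := by
    simp only [← Real.rpow_add hn]
    congr 1; simp; ring
  have hqe : (((k + N : ℕ) : ℝ) + 1) ^ ((A + s).re - 1) =
      (((k + N : ℕ) : ℝ) + 1) ^ (s - lam).re * (((k + N : ℕ) : ℝ) + 1) ^ ((A + lam).re - 1) := by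
    simp only [← Real.rpow_add hq]
    congr 1; simp; ring
  have hke : ((k : ℝ) + 1) ^ (-(A + lam).re) * ((k : ℝ) + 1) ^ ((s - lam).re - 1) *
      ((k : ℝ) + 1) ^ 2 = ((k : ℝ) + 1) ^ ((A + s).re - 1) * ((k : ℝ) + 1) ^ 3 *
      ((k : ℝ) + 1) ^ (-2 * (A + lam).re - 1) := by
    rw [← Real.rpow_natCast _ 2, ← Real.rpow_natCast _ 3]
    simp only [← Real.rpow_add hκ]
    congr 1; simp; ring
  rw [Tn]
  clear_value EP NP P1 Qn E G
  clear Tn hE gb gk nb db dp u b b1 b2 b3 pos hN hη hx₁ hx₂ hx₃ hlam has hηp hηm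
  have f1 : (0 : ℝ) < N.factorial := by positivity
  have f2 : (0 : ℝ) < k.factorial := by positivity
  have f3 : (0 : ℝ) < M.factorial := by positivity
  have f4 : (0 : ℝ) < (k + N).factorial := by positivity
  have r1 := Real.rpow_pos_of_pos hn (3 - 3 * A - s).re
  have r2 := Real.rpow_pos_of_pos hn ((A + s - lam).re - 1)
  have r3 := Real.rpow_pos_of_pos hn ((A + lam).re - 1)
  have r4 := Real.rpow_pos_of_pos hn lam.re
  have r5 := Real.rpow_pos_of_pos hn (1 - (A + lam).re)
  have r6 := Real.rpow_pos_of_pos hq ((A + s).re - 1)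
  have r7 := Real.rpow_pos_of_pos hq (s - lam).re
  have r8 := Real.rpow_pos_of_pos hq ((A + lam).re - 1)
  have r9 := Real.rpow_pos_of_pos hκ (-(A + lam).re)
  have r10 := Real.rpow_pos_of_pos hκ ((s - lam).re - 1)
  have r11 := Real.rpow_pos_of_pos hκ ((A + s).re - 1)
  have r12 := Real.rpow_pos_of_pos hκ (-2 * (A + lam).re - 1)
  have r13 := Real.rpow_pos_of_pos hm ((A + lam).re - 1)
  have r14 : (0 : ℝ) < 2 ^ |(A + lam).re - 1| := by positivity
  have r15 : (0 : ℝ) < ((k : ℝ) + 1) ^ 2 := by positivity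
  have r16 : (0 : ℝ) < ((k : ℝ) + 1) ^ 3 := by positivity
  generalize ((N : ℝ) + 1) ^ (3 - 3 * A - s).re = n1 at *
  generalize ((N : ℝ) + 1) ^ ((A + s - lam).re - 1) = n2 at *
  generalize ((N : ℝ) + 1) ^ ((A + lam).re - 1) = n3 at *
  generalize ((N : ℝ) + 1) ^ lam.re = n4 at *
  generalize ((N : ℝ) + 1) ^ (1 - (A + lam).re) = n5 at *
  generalize (((k + N : ℕ) : ℝ) + 1) ^ ((A + s).re - 1) = q6 at *
  generalize (((k + N : ℕ) : ℝ) + 1) ^ (s - lam).re = q7 at *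
  generalize (((k + N : ℕ) : ℝ) + 1) ^ ((A + lam).re - 1) = q8 at *
  generalize ((k : ℝ) + 1) ^ (-(A + lam).re) = k9 at *
  generalize ((k : ℝ) + 1) ^ ((s - lam).re - 1) = k10 at *
  generalize ((k : ℝ) + 1) ^ ((A + s).re - 1) = k11 at *
  generalize ((k : ℝ) + 1) ^ (-2 * (A + lam).re - 1) = k12 at *
  generalize ((M : ℝ) + 1) ^ ((A + lam).re - 1) = m13 at *
  generalize (2 : ℝ) ^ |(A + lam).re - 1| = t14 at *
  generalize ((k : ℝ) + 1) ^ 2 = k15 at *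
  generalize ((k : ℝ) + 1) ^ 3 = k16 at *
  generalize (N.factorial : ℝ) = F1 at *
  generalize (k.factorial : ℝ) = F2 at *
  generalize (M.factorial : ℝ) = F3 at *
  generalize ((k + N).factorial : ℝ) = F4 at *
  have P1b : P1 ≤ D * (F4 * q6) / (d * (F2 * k11)) := by
    rw [le_div_iff₀ (by positivity)]; linarith
  have EPb : (F1 * n4) * (F4 * q7) / (Cd * (F2 * k10) * (G * k15)) ≤ EP := by
    rw [div_le_iff₀ (by positivity)]; linarith
  calc n1 * (P1 * NP) / (F2 * F3 * EP * Qn)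
      ≤ n1 * ((D * (F4 * q6) / (d * (F2 * k11))) * (Cn * (F2 * k9 * (F3 * m13) * (F1 * n2)))) /
        (F2 * F3 * ((F1 * n4) * (F4 * q7) / (Cd * (F2 * k10) * (G * k15))) * (c1 * c2 * c3 * k16)) := by
        gcongr
    _ = (D * d⁻¹ * Cn * (Cd * G * (c1 * c2 * c3)⁻¹)) * m13 * (q6 / q7) * ((n1 * n2) / n4) *
        ((k9 * k10 * k15) / (k11 * k16)) := by
        field_simp
    _ = (D * d⁻¹ * Cn * (Cd * G * (c1 * c2 * c3)⁻¹)) * m13 * q8 * ((n1 * n2) / n4) * k12 := by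
        rw [hke, hqe]; field_simp
    _ ≤ (D * d⁻¹ * Cn * (Cd * G * (c1 * c2 * c3)⁻¹)) * m13 * (t14 * n3) * ((n1 * n2) / n4) * k12 := by
        gcongr
    _ = (D * d⁻¹ * Cn * (Cd * G * (c1 * c2 * c3)⁻¹)) * m13 * t14 * (n1 * n2 * n3 / n4) * k12 := by ring
    _ = (D * d⁻¹ * Cn * (Cd * G * (c1 * c2 * c3)⁻¹)) * m13 * t14 * n5 * k12 := by
        rw [hNe, mul_div_cancel_left₀ _ r4.ne']
    _ = _ := by ring

theorem limit_sum (T : ℕ → ℕ → ℂ) (f : ℕ → ℂ) (L : ℂ) (σ C : ℝ) (hσ : 0 < σ) (hC : 0 < C)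
    (k0 : ℕ)
    (hT : ∀ k, Tendsto (fun N => T N k) atTop (𝓝 (f k)))
    (hL : Tendsto (fun N : ℕ => ∑ k ∈ Finset.range (N + 1), T N k) atTop (𝓝 L))
    (hb : ∀ k M : ℕ, k0 ≤ k → ‖T (k + M) k‖ ≤
      C * (((k : ℝ) + 1) ^ (-2 * σ - 1) * ((M : ℝ) + 1) ^ (σ - 1)
        * (((k + M : ℕ) : ℝ) + 1) ^ (1 - σ))) :
    HasSum f L := by
  classical
  set C1 : ℝ := C * 2 ^ |1 - σ| with hC1
  have hC10 : 0 < C1 := by positivity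
  -- first half
  have first : ∀ N k : ℕ, k0 ≤ k → 2 * k ≤ N → ‖T N k‖ ≤ C1 * ((k : ℝ) + 1) ^ (-2 * σ - 1) := by
    intro N k hk hkN
    obtain ⟨M, rfl⟩ : ∃ M, N = k + M := ⟨N - k, by omega⟩
    refine (hb k M hk).trans ?_
    have hkM : (k : ℝ) ≤ M := by exact_mod_cast (by omega : k ≤ M)
    have hk0 : (0 : ℝ) ≤ k := by positivity
    have hm : (0 : ℝ) < (M : ℝ) + 1 := by positivity
    have h := rpow_le_two (((k + M : ℕ) : ℝ) + 1) ((M : ℝ) + 1) (1 - σ) hm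
      (by push_cast; linarith) (by push_cast; linarith)
    have e : ((M : ℝ) + 1) ^ (σ - 1) * ((M : ℝ) + 1) ^ (1 - σ) = 1 := by
      rw [← Real.rpow_add hm]; simp
    calc _ ≤ C * (((k : ℝ) + 1) ^ (-2 * σ - 1) * ((M : ℝ) + 1) ^ (σ - 1)
        * (2 ^ |1 - σ| * ((M : ℝ) + 1) ^ (1 - σ))) := by gcongr
      _ = C1 * ((k : ℝ) + 1) ^ (-2 * σ - 1) *
          (((M : ℝ) + 1) ^ (σ - 1) * ((M : ℝ) + 1) ^ (1 - σ)) := by rw [hC1]; ring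
      _ = _ := by rw [e, mul_one]
  set C2 : ℝ := C * 2 ^ |2 * σ + 1| with hC2
  have hC20 : 0 < C2 := by positivity
  have second : ∀ k M : ℕ, k0 ≤ k → M < k → ‖T (k + M) k‖ ≤
      C2 * (((k + M : ℕ) : ℝ) + 1) ^ (-σ) * ((M : ℝ) + 1) ^ (-1 - σ) := by
    intro k M hk hkN
    refine (hb k M hk).trans ?_
    have hkM : (M : ℝ) ≤ k := by exact_mod_cast hkN.le
    have hk0 : (0 : ℝ) ≤ k := by positivity
    have hm0 : (0 : ℝ) ≤ M := by positivity
    have hm : (0 : ℝ) < (M : ℝ) + 1 := by positivity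
    have hκ : (0 : ℝ) < (k : ℝ) + 1 := by positivity
    have hn : (0 : ℝ) < ((k + M : ℕ) : ℝ) + 1 := by positivity
    have h := rpow_le_two (((k + M : ℕ) : ℝ) + 1) ((k : ℝ) + 1) (2 * σ + 1) hκ
      (by push_cast; linarith) (by push_cast; linarith)
    have hmn : (M : ℝ) + 1 ≤ ((k + M : ℕ) : ℝ) + 1 := by push_cast; linarith
    set n : ℝ := ((k + M : ℕ) : ℝ) + 1 with hndef
    have h1 : ((k : ℝ) + 1) ^ (-2 * σ - 1) ≤ 2 ^ |2 * σ + 1| * n ^ (-2 * σ - 1) := by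
      rw [show -2 * σ - 1 = -(2 * σ + 1) by ring, Real.rpow_neg hκ.le, Real.rpow_neg hn.le,
        ← div_eq_mul_inv, le_div_iff₀ (by positivity), inv_mul_le_iff₀ (by positivity)]
      linarith
    have h2 : ((M : ℝ) + 1) ^ (σ - 1) ≤ ((M : ℝ) + 1) ^ (-1 - σ) * n ^ (2 * σ) := by
      rw [show σ - 1 = (-1 - σ) + 2 * σ by ring, Real.rpow_add hm]
      gcongr
    have e : n ^ (-2 * σ - 1) * n ^ (2 * σ) * n ^ (1 - σ) = n ^ (-σ) := by
      simp only [← Real.rpow_add hn]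
      congr 1; ring
    calc _ ≤ C * ((2 ^ |2 * σ + 1| * n ^ (-2 * σ - 1)) *
          (((M : ℝ) + 1) ^ (-1 - σ) * n ^ (2 * σ)) * n ^ (1 - σ)) := by gcongr
      _ = C2 * (n ^ (-2 * σ - 1) * n ^ (2 * σ) * n ^ (1 - σ)) * ((M : ℝ) + 1) ^ (-1 - σ) := by
          rw [hC2]; ring
      _ = _ := by rw [e]
  have sm : ∀ t : ℝ, t < -1 → Summable fun k : ℕ => ((k : ℝ) + 1) ^ t := by
    intro t ht
    have := (summable_nat_add_iff 1).2 (Real.summable_nat_rpow.2 ht)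
    simpa using this
  set bd : ℕ → ℝ := fun k => if k < k0 then ‖f k‖ + 1 else C1 * ((k : ℝ) + 1) ^ (-2 * σ - 1)
    with hbd
  have bds : Summable bd := by
    refine (summable_nat_add_iff k0).1 ?_
    have h := (summable_nat_add_iff k0).2 ((sm (-2 * σ - 1) (by linarith)).mul_left C1)
    refine h.congr fun k => ?_
    simp [hbd]
  set AN : ℕ → ℕ → ℂ := fun N k => if 2 * k ≤ N then T N k else 0 with hAN
  have ANt : ∀ k, Tendsto (fun N => AN N k) atTop (𝓝 (f k)) := by
    intro k
    refine (hT k).congr' ?_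
    filter_upwards [eventually_ge_atTop (2 * k)] with N hN
    simp [hAN, hN]
  have ANb : ∀ᶠ N in atTop, ∀ k, ‖AN N k‖ ≤ bd k := by
    have h : ∀ᶠ N in atTop, ∀ k ∈ Finset.range k0, ‖AN N k‖ ≤ ‖f k‖ + 1 := by
      rw [Finset.eventually_all]
      intro k _
      have := (ANt k).norm.eventually (ge_mem_nhds (lt_add_one ‖f k‖))
      exact this
    filter_upwards [h] with N hN k
    by_cases hk : k < k0
    · simpa [hbd, hk] using hN k (Finset.mem_range.2 hk)
    · simp only [hbd, hk, if_false]
      by_cases h2 : 2 * k ≤ N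
      · simpa [hAN, h2] using first N k (not_lt.1 hk) h2
      · simp only [hAN, h2, if_false, norm_zero]
        positivity
  have t1 := tendsto_tsum_of_dominated_convergence bds ANt ANb
  have fs : Summable f := by
    refine Summable.of_norm_bounded bds fun k => ?_
    refine le_of_tendsto (ANt k).norm ?_
    filter_upwards [ANb] with N hN using hN k
  have tA : ∀ N, ∑' k, AN N k = ∑ k ∈ Finset.range (N + 1), AN N k := by
    intro N
    refine tsum_eq_sum fun k hk => ?_
    have : ¬ 2 * k ≤ N := by
      intro h
      exact hk (Finset.mem_range.2 (by omega))
    simp [hAN, this]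
  set S : ℝ := ∑' j : ℕ, ((j : ℝ) + 1) ^ (-1 - σ) with hS
  have sS := sm (-1 - σ) (by linarith)
  have t2 : Tendsto (fun N : ℕ => ∑ k ∈ Finset.range (N + 1), T N k -
      ∑ k ∈ Finset.range (N + 1), AN N k) atTop (𝓝 0) := by
    have z : Tendsto (fun N : ℕ => C2 * ((N : ℝ) + 1) ^ (-σ) * S) atTop (𝓝 0) := by
      have h0 : Tendsto (fun N : ℕ => (N : ℝ) + 1) atTop atTop :=
        tendsto_atTop_add_const_right _ _ tendsto_natCast_atTop_atTop
      have := (((tendsto_rpow_neg_atTop hσ).comp h0).const_mul C2).mul_const S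
      simpa using this
    refine squeeze_zero_norm' ?_ z
    filter_upwards [eventually_ge_atTop (2 * k0)] with N hN
    rw [← Finset.sum_sub_distrib]
    refine (norm_sum_le _ _).trans ?_
    calc _ ≤ ∑ k ∈ Finset.range (N + 1),
          C2 * ((N : ℝ) + 1) ^ (-σ) * (((N - k : ℕ) : ℝ) + 1) ^ (-1 - σ) := by
          refine Finset.sum_le_sum fun k hk => ?_
          have hk' := Finset.mem_range.1 hk
          by_cases h2 : 2 * k ≤ N
          · simp only [hAN, h2, if_true, sub_self, norm_zero]
            positivity
          · simp only [hAN, h2, if_false, sub_zero]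
            obtain ⟨M, rfl⟩ : ∃ M, N = k + M := ⟨N - k, by omega⟩
            rw [Nat.add_sub_cancel_left]
            exact second k M (by omega) (by omega)
      _ = C2 * ((N : ℝ) + 1) ^ (-σ) *
          ∑ k ∈ Finset.range (N + 1), ((k : ℝ) + 1) ^ (-1 - σ) := by
          rw [← Finset.mul_sum, ← Finset.sum_range_reflect]
          congr 1
          refine Finset.sum_congr rfl fun j hj => ?_
          have hj2 := Finset.mem_range.1 hj
          rw [show N - (N + 1 - 1 - j) = j by omega]
      _ ≤ _ := by
          gcongr
          exact sS.sum_le_tsum _ (fun i _ => by positivity)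
  have t3 : Tendsto (fun N : ℕ => ∑ k ∈ Finset.range (N + 1), T N k) atTop
      (𝓝 (0 + ∑' k, f k)) := by
    refine (t2.add t1).congr fun N => ?_
    rw [tA]; ring
  have := tendsto_nhds_unique hL t3
  rw [this, zero_add]
  exact fs.hasSum

/-- Equation (5.2): the symmetric expansion of closed string amplitudes
when `u - (x₁+x₂+x₃)` is an integer `a`. -/
theorem closed_symmetric_expansion_int (a : ℤ) (lam x₁ x₂ x₃ s : ℂ)
    (hs : s = x₁ + x₂ + x₃)
    (hre : 0 < (lam + a).re)
    (ηp ηm : ℕ → ℂ)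
    (hη : ∀ k : ℕ, ηp k + ηm k = s + k
      ∧ (-(k : ℂ) - lam) * (ηp k - lam) * (ηm k - lam)
          = (x₁ - lam) * (x₂ - lam) * (x₃ - lam))
    (hx₁ : ∀ m : ℕ, x₁ ≠ -(m : ℂ))
    (hx₂ : ∀ m : ℕ, x₂ ≠ -(m : ℂ))
    (hx₃ : ∀ m : ℕ, x₃ ≠ -(m : ℂ))
    (hlam : ∀ m : ℕ, lam ≠ -(m : ℂ))
    (has₁ : ∀ m : ℕ, (a : ℂ) + s - x₁ ≠ -(m : ℂ))
    (has₂ : ∀ m : ℕ, (a : ℂ) + s - x₂ ≠ -(m : ℂ))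
    (has₃ : ∀ m : ℕ, (a : ℂ) + s - x₃ ≠ -(m : ℂ))
    (has : ∀ m : ℕ, (a : ℂ) + s ≠ -(m : ℂ))
    (hηp : ∀ k : ℕ, ∀ m : ℕ, ηp k ≠ -(m : ℂ))
    (hηm : ∀ k : ℕ, ∀ m : ℕ, ηm k ≠ -(m : ℂ)) :
    Tendsto (fun N : ℕ => ∑ k ∈ Finset.range N,
        ((-1 : ℂ) ^ k / (k.factorial : ℂ))
        * (gpoch (1 - ηp k) ((k : ℤ) - a) * gpoch (1 - ηm k) ((k : ℤ) - a)
            / poch ((a : ℂ) + s) k)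
        * (1 / (x₁ + k) + 1 / (x₂ + k) + 1 / (x₃ + k) - 1 / (lam + k)))
      atTop
      (𝓝 (Complex.Gamma x₁ * Complex.Gamma x₂ * Complex.Gamma x₃
            * Complex.Gamma ((a : ℂ) + s)
          / (Complex.Gamma ((a : ℂ) + s - x₁)
            * Complex.Gamma ((a : ℂ) + s - x₂)
            * Complex.Gamma ((a : ℂ) + s - x₃)))) := by
  have hre' : 0 < ((a : ℂ) + lam).re := by rwa [add_comm]
  obtain ⟨C, hC, k0, hb⟩ := Tm_bound (a : ℂ) lam x₁ x₂ x₃ s ηp ηm hη hx₁ hx₂ hx₃ hlam has hηp hηm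
  have hL := R_tendsto (a : ℂ) s x₁ x₂ x₃ hs hx₁ hx₂ hx₃
  have hT := fun k => Tm_tendsto a s x₁ x₂ x₃ ηp ηm k (hη k).1 (hηp k) (hηm k) has
  have hH := limit_sum (Tm a s x₁ x₂ x₃ ηp ηm) _ _ _ C hre' hC k0 hT
    (hL.congr fun N => (sum_Tm (a : ℂ) lam x₁ x₂ x₃ s hs ηp ηm hη hx₁ hx₂ hx₃ hlam hηp hηm N).symm) hb
  have hG := Complex.Gamma_ne_zero has
  have h := (hH.mul_left (Complex.Gamma ((a : ℂ) + s))).tendsto_sum_nat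
  have ne : ∀ (z : ℂ) (k : ℕ), (∀ m : ℕ, z ≠ -(m : ℂ)) → z + k ≠ 0 :=
    fun z k hz h0 => hz k (by linear_combination h0)
  convert h using 2
  · rename_i N
    refine Finset.sum_congr rfl fun k _ => ?_
    rw [mul_inv_cancel_left₀ hG, bracket_eq lam x₁ x₂ x₃ k (ηp k) (ηm k) (ne _ _ hlam) (ne _ _ hx₁)
      (ne _ _ hx₂) (ne _ _ hx₃) (by rw [(hη k).1, hs]) (hη k).2]
  · ring
end
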